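/- Let n ≥ 2 and 2n/(n−1) ≤ p < ∞. Suppose there is 1/p− local smoothing for the half-wave propagator: for every σ < 1/p there is a constant C_σ with (∫₁² ‖⟨D⟩^{σ−s̄_p} e^{it√(−Δ)} f‖^p_{L^p(ℝⁿ)} dt)^{1/p} ≤ C_σ‖f‖_{L^p(ℝⁿ)} for all f ∈ S(ℝⁿ). Then for every δ > δ(p) := n(1/2 − 1/p) − 1/2 there is a constant C such that the maximal Bochner–Riesz estimate (∫_{ℝⁿ} sup_{t>0} |S_t^δ f(x)|^p dx)^{1/p} ≤ C‖f‖_{L^p(ℝⁿ)} holds for all f ∈ S(ℝⁿ). -/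

import Mathlib

open MeasureTheory
open scoped RealInnerProductSpace ENNReal

noncomputable section

/-- `ℝⁿ` as a euclidean space. -/
abbrev V (n : ℕ) := EuclideanSpace ℝ (Fin n)

/-- The Fourier transform `f̂(ξ) = ∫_{ℝⁿ} e^{−i⟨y,ξ⟩} f(y) dy`. -/
def FT {n : ℕ} (f : V n → ℂ) (ξ : V n) : ℂ :=
  ∫ y : V n, Complex.exp (-(Complex.I * ((⟪y, ξ⟫ : ℝ) : ℂ))) * f y

/-- The Bessel potential `⟨D⟩^s g (x) = (2π)^{−n} ∫ e^{i⟨x,ξ⟩}(1+|ξ|²)^{s/2} ĝ(ξ) dξ`. -/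
def besselD {n : ℕ} (s : ℝ) (g : V n → ℂ) (x : V n) : ℂ :=
  ((((2 * Real.pi) ^ n)⁻¹ : ℝ) : ℂ) *
    ∫ ξ : V n, Complex.exp (Complex.I * ((⟪x, ξ⟫ : ℝ) : ℂ)) *
      (((1 + ‖ξ‖ ^ 2) ^ (s / 2) : ℝ) : ℂ) * FT g ξ

/-- The regularity exponent `s̄_p = (n−1)|1/2 − 1/p|`. -/
def sBar (n : ℕ) (p : ℝ) : ℝ := (n - 1) * |1 / 2 - 1 / p|

/-- The half-wave propagator
`e^{it√(−Δ)}f(x) = (2π)^{−n} ∫ e^{i(⟨x,ξ⟩+t|ξ|)} f̂(ξ) dξ`. -/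
def halfWave {n : ℕ} (t : ℝ) (f : V n → ℂ) (x : V n) : ℂ :=
  ((((2 * Real.pi) ^ n)⁻¹ : ℝ) : ℂ) *
    ∫ ξ : V n, Complex.exp (Complex.I * (((⟪x, ξ⟫ + t * ‖ξ‖ : ℝ)) : ℂ)) * FT f ξ

/-- `r₊^δ := r^δ` for `r > 0` and `0` for `r ≤ 0`. -/
def posRpow (r δ : ℝ) : ℝ := if 0 < r then r ^ δ else 0

/-- The Bochner–Riesz operator
`S_t^δ f(x) = (2π)^{−n} ∫ e^{i⟨x,ξ⟩} (1−t|ξ|)₊^δ f̂(ξ) dξ`. -/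
def bochnerRiesz {n : ℕ} (δ t : ℝ) (f : V n → ℂ) (x : V n) : ℂ :=
  ((((2 * Real.pi) ^ n)⁻¹ : ℝ) : ℂ) *
    ∫ ξ : V n, Complex.exp (Complex.I * ((⟪x, ξ⟫ : ℝ) : ℂ)) *
      ((posRpow (1 - t * ‖ξ‖) δ : ℝ) : ℂ) * FT f ξ

namespace LocalSmoothing

open Set Filter Topology
open scoped FourierTransform SchwartzMap ContDiff

variable {n : ℕ}

/-! ### Interpolation -/

lemma lintegral_Ioo_rpow {s r : ℝ} (hs : 0 < s) (hr : 0 ≤ r) :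
    ∫⁻ l in Ioo 0 r, ENNReal.ofReal (l ^ (s - 1)) = ENNReal.ofReal (r ^ s / s) := by
  rw [← ofReal_integral_eq_lintegral_ofReal]
  · congr 1
    rw [← integral_Ioc_eq_integral_Ioo, ← intervalIntegral.integral_of_le hr,
      integral_rpow (Or.inl (by linarith))]
    simp [Real.zero_rpow hs.ne']
  · have := (intervalIntegral.intervalIntegrable_rpow' (a := 0) (b := r)
      (r := s - 1) (by linarith)).1
    exact this.mono_set Ioo_subset_Ioc_self
  · filter_upwards [ae_restrict_mem measurableSet_Ioo] with l hl
    exact Real.rpow_nonneg hl.1.le _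

lemma lintegral_indicator_rpow {s : ℝ} (hs : 0 < s) (a : ℝ≥0∞) :
    ∫⁻ l in Ioi (0 : ℝ), {l : ℝ | ENNReal.ofReal l < a}.indicator
      (fun l => ENNReal.ofReal (l ^ (s - 1))) l = a ^ s * ENNReal.ofReal s⁻¹ := by
  have key : ∀ r : ℝ, 0 ≤ r → ∫⁻ l in Ioi (0 : ℝ),
      {l : ℝ | ENNReal.ofReal l < ENNReal.ofReal r}.indicator
        (fun l => ENNReal.ofReal (l ^ (s - 1))) l = ENNReal.ofReal r ^ s * ENNReal.ofReal s⁻¹ := by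
    intro r hr
    have hm : MeasurableSet {l : ℝ | ENNReal.ofReal l < ENNReal.ofReal r} :=
      measurableSet_lt ENNReal.measurable_ofReal measurable_const
    rw [lintegral_indicator hm, Measure.restrict_restrict hm]
    have : {l : ℝ | ENNReal.ofReal l < ENNReal.ofReal r} ∩ Ioi 0 = Ioo 0 r := by
      ext l
      simp only [mem_inter_iff, mem_ofPred_eq, mem_Ioi, mem_Ioo]
      constructor
      · rintro ⟨h1, h2⟩
        exact ⟨h2, (ENNReal.ofReal_lt_ofReal_iff_of_nonneg h2.le).1 h1⟩
      · rintro ⟨h1, h2⟩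
        exact ⟨(ENNReal.ofReal_lt_ofReal_iff_of_nonneg h1.le).2 h2, h1⟩
    rw [this, lintegral_Ioo_rpow hs hr, div_eq_mul_inv, ENNReal.ofReal_mul (Real.rpow_nonneg hr _),
      ENNReal.ofReal_rpow_of_nonneg hr hs.le]
  by_cases ha : a = ⊤
  · subst ha
    rw [ENNReal.top_rpow_of_pos hs, ENNReal.top_mul (by simpa using hs)]
    have h1 : Tendsto (fun N : ℕ => (ENNReal.ofReal N) ^ s * ENNReal.ofReal s⁻¹) atTop
        (𝓝 (⊤ ^ s * ENNReal.ofReal s⁻¹)) := by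
      refine ENNReal.Tendsto.mul_const ?_ (Or.inl (by simp [ENNReal.top_rpow_of_pos hs]))
      refine ((ENNReal.continuous_rpow_const (y := s)).tendsto _).comp ?_
      simpa using ENNReal.tendsto_nat_nhds_top
    rw [ENNReal.top_rpow_of_pos hs, ENNReal.top_mul (by simpa using hs)] at h1
    refine top_le_iff.1 (le_of_tendsto h1 (Eventually.of_forall fun N => ?_))
    rw [← key N (by positivity)]
    refine lintegral_mono fun l => ?_
    refine indicator_le_indicator_of_subset (fun l hl => ?_) (fun _ => zero_le) l
    simp only [mem_ofPred_eq] at hl ⊢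
    exact ENNReal.ofReal_lt_top
  · have := key a.toReal ENNReal.toReal_nonneg
    rwa [ENNReal.ofReal_toReal ha] at this

/-- Weak-type bounds in terms of the large values of `f` give strong-type bounds. -/
lemma lintegral_rpow_le_of_weak {α β : Type*} [MeasurableSpace α] [MeasurableSpace β]
    {μ : Measure α} {ν : Measure β} [SFinite μ] [SFinite ν] {q p : ℝ} (hq : 0 < q) (hqp : q < p)
    {c : ℝ} (hc : 0 < c) (A : ℝ≥0∞) {f : α → ℝ≥0∞} (hf : Measurable f) {F : β → ℝ≥0∞}
    (h : ∀ l : ℝ, 0 < l → ν {y | ENNReal.ofReal l < F y} ≤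
      A * ENNReal.ofReal (l ^ (-q)) * ∫⁻ x in {x | ENNReal.ofReal (c * l) < f x}, f x ^ q ∂μ) :
    ∫⁻ y, F y ^ p ∂ν ≤
      ENNReal.ofReal (p * (p - q)⁻¹ * c⁻¹ ^ (p - q)) * A * ∫⁻ x, f x ^ p ∂μ := by
  have hp : 0 < p := hq.trans hqp
  obtain ⟨G, hG, hGF, hGi⟩ := exists_measurable_le_lintegral_eq ν (fun y => F y ^ p)
  rw [hGi]
  set H : β → ℝ≥0∞ := fun y => G y ^ p⁻¹ with hH
  have hHm : Measurable H := hG.pow_const _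
  have hHF : ∀ y, H y ≤ F y := fun y => by
    have := ENNReal.rpow_le_rpow (hGF y) (inv_nonneg.2 hp.le)
    simpa [hH, ← ENNReal.rpow_mul, mul_inv_cancel₀ hp.ne'] using this
  have hGH : ∀ y, G y = ENNReal.ofReal p * (H y ^ p * ENNReal.ofReal p⁻¹) := fun y => by
    rw [mul_comm (H y ^ p), ← mul_assoc, ← ENNReal.ofReal_mul hp.le, mul_inv_cancel₀ hp.ne']
    simp [hH, ← ENNReal.rpow_mul, inv_mul_cancel₀ hp.ne']
  have hmeas1 : Measurable (Function.uncurry fun (y : β) (l : ℝ) =>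
      {l : ℝ | ENNReal.ofReal l < H y}.indicator (fun l => ENNReal.ofReal (l ^ (p - 1))) l) := by
    have : (Function.uncurry fun (y : β) (l : ℝ) =>
      {l : ℝ | ENNReal.ofReal l < H y}.indicator (fun l => ENNReal.ofReal (l ^ (p - 1))) l) =
      {z : β × ℝ | ENNReal.ofReal z.2 < H z.1}.indicator
        (fun z => ENNReal.ofReal (z.2 ^ (p - 1))) := by
      ext ⟨y, l⟩; simp [indicator]
    rw [this]
    exact (by fun_prop : Measurable fun z : β × ℝ => ENNReal.ofReal (z.2 ^ (p - 1))).indicator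
      (measurableSet_lt (by fun_prop) (by fun_prop))
  have hmeas2 : Measurable (Function.uncurry fun (l : ℝ) (x : α) =>
      ENNReal.ofReal (l ^ (p - q - 1)) *
        {x | ENNReal.ofReal (c * l) < f x}.indicator (fun x => f x ^ q) x) := by
    have : (Function.uncurry fun (l : ℝ) (x : α) =>
      ENNReal.ofReal (l ^ (p - q - 1)) *
        {x | ENNReal.ofReal (c * l) < f x}.indicator (fun x => f x ^ q) x) =
      fun z => ENNReal.ofReal (z.1 ^ (p - q - 1)) *
        {z : ℝ × α | ENNReal.ofReal (c * z.1) < f z.2}.indicator (fun z => f z.2 ^ q) z := by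
      ext ⟨y, l⟩; simp [indicator]
    rw [this]
    refine Measurable.mul (by fun_prop) (Measurable.indicator (by fun_prop)
      (measurableSet_lt (by fun_prop) (by fun_prop)))
  calc ∫⁻ y, G y ∂ν
      = ENNReal.ofReal p * ∫⁻ y, (∫⁻ l in Ioi (0 : ℝ), {l : ℝ | ENNReal.ofReal l < H y}.indicator
          (fun l => ENNReal.ofReal (l ^ (p - 1))) l) ∂ν := by
        rw [← lintegral_const_mul' _ _ ENNReal.ofReal_ne_top]
        refine lintegral_congr fun y => ?_
        rw [lintegral_indicator_rpow hp, ← hGH]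
    _ = ENNReal.ofReal p * ∫⁻ l in Ioi (0 : ℝ), ENNReal.ofReal (l ^ (p - 1)) *
          ν {y | ENNReal.ofReal l < H y} := by
        rw [lintegral_lintegral_swap hmeas1.aemeasurable]
        congr 1
        refine lintegral_congr fun l => ?_
        rw [← lintegral_indicator_const (measurableSet_lt measurable_const hHm)]
        rfl
    _ ≤ ENNReal.ofReal p * ∫⁻ l in Ioi (0 : ℝ), A * ∫⁻ x,
          ENNReal.ofReal (l ^ (p - q - 1)) *
            {x | ENNReal.ofReal (c * l) < f x}.indicator (fun x => f x ^ q) x ∂μ := by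
        gcongr ENNReal.ofReal p * ?_
        refine setLIntegral_mono' measurableSet_Ioi fun l hl => ?_
        have hl : (0 : ℝ) < l := hl
        have h2 := (measure_mono (fun y (hy : ENNReal.ofReal l < H y) => hy.trans_le (hHF y))).trans
          (h l hl)
        calc _ ≤ ENNReal.ofReal (l ^ (p - 1)) * (A * ENNReal.ofReal (l ^ (-q)) *
              ∫⁻ x in {x | ENNReal.ofReal (c * l) < f x}, f x ^ q ∂μ) := by gcongr; exact h2
          _ = A * (ENNReal.ofReal (l ^ (p - 1)) * ENNReal.ofReal (l ^ (-q)) *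
              ∫⁻ x in {x | ENNReal.ofReal (c * l) < f x}, f x ^ q ∂μ) := by ring
          _ = _ := by
            rw [← ENNReal.ofReal_mul (by positivity), ← Real.rpow_add hl,
              lintegral_const_mul' _ _ ENNReal.ofReal_ne_top,
              lintegral_indicator (measurableSet_lt measurable_const hf)]
            ring_nf
    _ = ENNReal.ofReal p * (A * ∫⁻ x, (∫⁻ l in Ioi (0 : ℝ),
          ENNReal.ofReal (l ^ (p - q - 1)) *
            {x | ENNReal.ofReal (c * l) < f x}.indicator (fun x => f x ^ q) x) ∂μ) := by
        have := hmeas2.lintegral_prod_right' (ν := μ)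
        simp only [Function.uncurry_apply_pair] at this
        rw [lintegral_const_mul _ this, lintegral_lintegral_swap hmeas2.aemeasurable]
    _ = ENNReal.ofReal p * (A * ∫⁻ x, f x ^ p *
          (ENNReal.ofReal (c⁻¹ ^ (p - q)) * ENNReal.ofReal (p - q)⁻¹) ∂μ) := by
        congr 2
        refine lintegral_congr fun x => ?_
        have : ∀ l : ℝ, ENNReal.ofReal (l ^ (p - q - 1)) *
            {x | ENNReal.ofReal (c * l) < f x}.indicator (fun x => f x ^ q) x =
            {l : ℝ | ENNReal.ofReal l < ENNReal.ofReal c⁻¹ * f x}.indicator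
              (fun l => ENNReal.ofReal (l ^ (p - q - 1))) l * f x ^ q := by
          intro l
          have : ENNReal.ofReal (c * l) < f x ↔ ENNReal.ofReal l < ENNReal.ofReal c⁻¹ * f x := by
            rw [ENNReal.ofReal_mul hc.le, ENNReal.ofReal_inv_of_pos hc, ← ENNReal.div_eq_inv_mul,
              ENNReal.lt_div_iff_mul_lt (Or.inl (by simpa using hc)) (Or.inl ENNReal.ofReal_ne_top),
              mul_comm]
          simp only [indicator, mem_ofPred_eq, this]
          split_ifs <;> simp
        simp_rw [this]
        rw [lintegral_mul_const, lintegral_indicator_rpow (by linarith : 0 < p - q),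
          ENNReal.mul_rpow_of_nonneg _ _ (by linarith),
          ENNReal.ofReal_rpow_of_pos (by positivity)]
        · have : f x ^ p = f x ^ (p - q) * f x ^ q := by
            rw [← ENNReal.rpow_add_of_nonneg _ _ (by linarith) hq.le]; ring_nf
          rw [this]; ring
        · exact (by fun_prop : Measurable fun l : ℝ => ENNReal.ofReal (l ^ (p - q - 1))).indicator
            (measurableSet_lt (by fun_prop) (by fun_prop))
    _ = _ := by
        rw [lintegral_mul_const _ (hf.pow_const _), mul_assoc p, ENNReal.ofReal_mul hp.le,
          ENNReal.ofReal_mul (inv_nonneg.2 (by linarith))]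
        ring

/-! ### The Hardy–Littlewood maximal function -/


/-- The centred Hardy–Littlewood maximal function. -/
def maxFn (f : V n → ℝ≥0∞) (x : V n) : ℝ≥0∞ :=
  ⨆ r : {r : ℝ // 0 < r}, (volume (Metric.ball x r))⁻¹ * ∫⁻ y in Metric.ball x r, f y

lemma volume_ball_eq (x : V n) {r : ℝ} (hr : 0 < r) :
    volume (Metric.ball x r) = ENNReal.ofReal (r ^ n) * volume (Metric.ball (0 : V n) 1) := by
  rw [Measure.addHaar_ball_of_pos _ _ hr, finrank_euclideanSpace_fin]

lemma setLIntegral_ball_le_maxFn (f : V n → ℝ≥0∞) (x : V n) {r : ℝ} (hr : 0 < r) :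
    ∫⁻ y in Metric.ball x r, f y ≤
      ENNReal.ofReal (r ^ n) * volume (Metric.ball (0 : V n) 1) * maxFn f x := by
  have h0 : volume (Metric.ball x r) ≠ 0 := (Metric.measure_ball_pos _ _ hr).ne'
  have h1 : volume (Metric.ball x r) ≠ ⊤ := measure_ball_lt_top.ne
  calc ∫⁻ y in Metric.ball x r, f y
      = volume (Metric.ball x r) *
          ((volume (Metric.ball x r))⁻¹ * ∫⁻ y in Metric.ball x r, f y) := by
        rw [← mul_assoc, ENNReal.mul_inv_cancel h0 h1, one_mul]
    _ ≤ volume (Metric.ball x r) * maxFn f x := by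
        gcongr
        exact le_iSup (fun r : {r : ℝ // 0 < r} =>
          (volume (Metric.ball x r))⁻¹ * ∫⁻ y in Metric.ball x r, f y) ⟨r, hr⟩
    _ = _ := by rw [volume_ball_eq x hr]

/-- The weak type `(1, 1)` bound. -/
lemma volume_maxFn_le (hn : 0 < n) (f : V n → ℝ≥0∞) {l : ℝ} (hl : 0 < l) :
    volume {x : V n | ENNReal.ofReal l < maxFn f x} ≤
      ENNReal.ofReal (5 ^ n) * ENNReal.ofReal l⁻¹ * ∫⁻ x, f x := by
  by_cases hI : ∫⁻ x, f x = ⊤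
  · rw [hI, ENNReal.mul_top]
    · exact le_top
    · refine mul_ne_zero ?_ ?_ <;> simp [hl]
  set b : ℝ≥0∞ := volume (Metric.ball (0 : V n) 1) with hb
  have hb0 : b ≠ 0 := (Metric.measure_ball_pos _ _ one_pos).ne'
  have hb1 : b ≠ ⊤ := measure_ball_lt_top.ne
  set t : Set (V n × ℝ) := {z | 0 < z.2 ∧
    ENNReal.ofReal l * volume (Metric.ball z.1 z.2) ≤ ∫⁻ y in Metric.ball z.1 z.2, f y} with ht
  set D : ℝ := (ENNReal.ofReal l⁻¹ * b⁻¹ * ∫⁻ x, f x).toReal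
  have hR : ∀ z ∈ t, z.2 ≤ D + 1 := by
    rintro ⟨x, r⟩ ⟨hr, hz⟩
    by_contra! hcon
    simp only at hr hz hcon
    rw [volume_ball_eq x hr, ← hb] at hz
    have h1 : ENNReal.ofReal (r ^ n) ≤ ENNReal.ofReal l⁻¹ * b⁻¹ * ∫⁻ x, f x := by
      calc ENNReal.ofReal (r ^ n)
          = ENNReal.ofReal l⁻¹ * b⁻¹ * (ENNReal.ofReal l * (ENNReal.ofReal (r ^ n) * b)) := by
            rw [ENNReal.ofReal_inv_of_pos hl]
            have h3 : (ENNReal.ofReal l)⁻¹ * ENNReal.ofReal l = 1 :=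
              ENNReal.inv_mul_cancel (by simpa using hl) ENNReal.ofReal_ne_top
            have h4 : b⁻¹ * b = 1 := ENNReal.inv_mul_cancel hb0 hb1
            calc _ = ENNReal.ofReal (r ^ n) * ((ENNReal.ofReal l)⁻¹ * ENNReal.ofReal l) *
                  (b⁻¹ * b) := by
                  rw [h3, h4, mul_one, mul_one]
              _ = _ := by ring
        _ ≤ _ := by gcongr; exact hz.trans (setLIntegral_le_lintegral _ _)
    have h2 : r ^ n ≤ D := by
      refine (ENNReal.ofReal_le_iff_le_toReal ?_).1 h1
      exact ENNReal.mul_ne_top (ENNReal.mul_ne_top ENNReal.ofReal_ne_top (by simpa using hb0)) hI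
    have h0 : 0 ≤ D := ENNReal.toReal_nonneg
    have h3 : r ^ 1 ≤ r ^ n := pow_le_pow_right₀ (by linarith) hn
    linarith
  obtain ⟨u, hut, hdisj, hcov⟩ := Vitali.exists_disjoint_subfamily_covering_enlargement_closedBall
    t (fun z => z.1) (fun z => z.2) (D + 1) hR 5 (by norm_num)
  have hcount : u.Countable := hdisj.countable_of_nonempty_interior fun z hz =>
    ⟨z.1, Metric.ball_subset_interior_closedBall (Metric.mem_ball_self (hut hz).1)⟩
  have hsub : {x : V n | ENNReal.ofReal l < maxFn f x} ⊆
      ⋃ z ∈ u, Metric.closedBall z.1 (5 * z.2) := by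
    intro x hx
    rw [mem_ofPred_eq, maxFn, lt_iSup_iff] at hx
    obtain ⟨⟨r, hr⟩, hx⟩ := hx
    have hxt : (x, r) ∈ t := by
      refine ⟨hr, ?_⟩
      simp only at hx ⊢
      rw [← ENNReal.le_div_iff_mul_le (Or.inl (Metric.measure_ball_pos _ _ hr).ne')
        (Or.inl measure_ball_lt_top.ne), ENNReal.div_eq_inv_mul]
      exact hx.le
    obtain ⟨z, hz, hsub⟩ := hcov _ hxt
    exact mem_biUnion hz (hsub (Metric.mem_closedBall_self hr.le))
  calc volume {x : V n | ENNReal.ofReal l < maxFn f x}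
      ≤ volume (⋃ z ∈ u, Metric.closedBall z.1 (5 * z.2)) := measure_mono hsub
    _ ≤ ∑' z : u, volume (Metric.closedBall z.1.1 (5 * z.1.2)) := measure_biUnion_le _ hcount _
    _ ≤ ∑' z : u, ENNReal.ofReal (5 ^ n) * ENNReal.ofReal l⁻¹ *
          ∫⁻ y in Metric.ball z.1.1 z.1.2, f y := by
        refine ENNReal.tsum_le_tsum fun z => ?_
        obtain ⟨hz0, hz1⟩ := hut z.2
        rw [Measure.addHaar_closedBall _ _ (by positivity), finrank_euclideanSpace_fin, mul_pow,
          ENNReal.ofReal_mul (by positivity), mul_assoc, mul_assoc, ← volume_ball_eq z.1.1 hz0]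
        gcongr
        rwa [ENNReal.ofReal_inv_of_pos hl, ← ENNReal.div_eq_inv_mul,
          ENNReal.le_div_iff_mul_le (Or.inl (by simpa using hl)) (Or.inl ENNReal.ofReal_ne_top),
          mul_comm]
    _ = ENNReal.ofReal (5 ^ n) * ENNReal.ofReal l⁻¹ *
          ∫⁻ y in ⋃ z ∈ u, Metric.ball z.1 z.2, f y := by
        rw [ENNReal.tsum_mul_left,
          lintegral_biUnion hcount (fun _ _ => Metric.isOpen_ball.measurableSet)
          (hdisj.mono fun z => Metric.ball_subset_closedBall)]
    _ ≤ _ := mul_le_mul_right (setLIntegral_le_lintegral _ _) _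

lemma maxFn_le_add_const (f g : V n → ℝ≥0∞) (hg : Measurable g) (c : ℝ≥0∞)
    (h : ∀ x, f x ≤ g x + c) (x : V n) :
    maxFn f x ≤ maxFn g x + c := by
  refine iSup_le fun r => ?_
  have h0 : volume (Metric.ball x (r : ℝ)) ≠ 0 := (Metric.measure_ball_pos _ _ r.2).ne'
  have h1 : volume (Metric.ball x (r : ℝ)) ≠ ⊤ := measure_ball_lt_top.ne
  calc _ ≤ (volume (Metric.ball x r))⁻¹ * ∫⁻ y in Metric.ball x r, (g y + c) := by
        gcongr; exact h _
    _ = (volume (Metric.ball x r))⁻¹ * (∫⁻ y in Metric.ball x r, g y) + c := by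
        rw [lintegral_add_left hg, mul_add]
        congr 1
        simp only [lintegral_const, MeasurableSet.univ, Measure.restrict_apply, univ_inter]
        rw [mul_comm c, ← mul_assoc, ENNReal.inv_mul_cancel h0 h1, one_mul]
    _ ≤ _ := by
        gcongr
        exact le_iSup (fun r : {r : ℝ // 0 < r} =>
          (volume (Metric.ball x r))⁻¹ * ∫⁻ y in Metric.ball x r, g y) r

/-- The Hardy–Littlewood maximal theorem. -/
lemma lintegral_maxFn_rpow_le (hn : 0 < n) {p : ℝ} (hp : 1 < p) :
    ∃ C : ℝ≥0∞, C ≠ ⊤ ∧ ∀ f : V n → ℝ≥0∞, Measurable f →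
      ∫⁻ x, maxFn f x ^ p ≤ C * ∫⁻ x, f x ^ p := by
  refine ⟨ENNReal.ofReal (p * (p - 1)⁻¹ * (2⁻¹ : ℝ)⁻¹ ^ (p - 1)) * (2 * ENNReal.ofReal (5 ^ n)),
    by finiteness, fun f hf => ?_⟩
  refine lintegral_rpow_le_of_weak (q := 1) (c := 2⁻¹) one_pos hp (by norm_num) _ hf fun l hl => ?_
  have hS : MeasurableSet {x | ENNReal.ofReal (2⁻¹ * l) < f x} :=
    measurableSet_lt measurable_const hf
  set g : V n → ℝ≥0∞ := {x | ENNReal.ofReal (2⁻¹ * l) < f x}.indicator f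
  have hle : ∀ x, maxFn f x ≤ maxFn g x + ENNReal.ofReal (2⁻¹ * l) := by
    refine maxFn_le_add_const _ _ (hf.indicator hS) _ fun x => ?_
    by_cases hx : x ∈ {x | ENNReal.ofReal (2⁻¹ * l) < f x}
    · rw [indicator_of_mem hx]
      exact le_self_add
    · simpa only [g, indicator_of_notMem hx, zero_add, mem_ofPred_eq, not_lt] using hx
  calc volume {y | ENNReal.ofReal l < maxFn f y}
      ≤ volume {y | ENNReal.ofReal (2⁻¹ * l) < maxFn g y} := by
        refine measure_mono fun y hy => ?_
        simp only [mem_ofPred_eq] at hy ⊢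
        have h1 := hy.trans_le (hle y)
        rw [show l = 2⁻¹ * l + 2⁻¹ * l by ring,
          ENNReal.ofReal_add (by positivity) (by positivity)] at h1
        exact (ENNReal.add_lt_add_iff_right (ENNReal.ofReal_ne_top)).1 (by
          convert h1 using 3; ring)
    _ ≤ ENNReal.ofReal (5 ^ n) * ENNReal.ofReal (2⁻¹ * l)⁻¹ * ∫⁻ x, g x :=
        volume_maxFn_le hn g (by positivity)
    _ = _ := by
        rw [lintegral_indicator hS]
        simp only [ENNReal.rpow_one, mul_inv, inv_inv, Real.rpow_neg_one]
        rw [ENNReal.ofReal_mul (by norm_num)]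
        simp only [ENNReal.ofReal_ofNat]
        ring

/-- Integration against dilates of a decaying kernel is controlled by the maximal function. -/
lemma lintegral_kernel_le_maxFn :
    ∃ C : ℝ≥0∞, C ≠ ⊤ ∧ ∀ (K : V n → ℝ≥0∞) (B : ℝ≥0∞),
      (∀ x, K x ≤ B * ENNReal.ofReal ((1 + ‖x‖) ^ (n + 1))⁻¹) → ∀ (s : ℝ), 0 < s →
      ∀ (f : V n → ℝ≥0∞), Measurable f → ∀ x : V n,
        ∫⁻ y, ENNReal.ofReal (s ^ n) * K (s • (x - y)) * f y ≤ C * B * maxFn f x := by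
  set b : ℝ≥0∞ := volume (Metric.ball (0 : V n) 1) with hb
  have hb1 : b ≠ ⊤ := measure_ball_lt_top.ne
  refine ⟨2 ^ (n + 1) * b * 2, by finiteness, fun K B hK s hs f hf x => ?_⟩
  have hpt : ∀ y, ENNReal.ofReal (s ^ n) * K (s • (x - y)) * f y ≤
      ∑' i : ℕ, ENNReal.ofReal (s ^ n) * B * 2 ^ (n + 1) * ((2 : ℝ≥0∞)⁻¹ ^ i) ^ (n + 1) *
        (Metric.ball x (2 ^ i / s)).indicator f y := by
    intro y
    obtain ⟨i, hi, hmin⟩ : ∃ i : ℕ, ‖s • (x - y)‖ < 2 ^ i ∧ ∀ j < i, 2 ^ j ≤ ‖s • (x - y)‖ := by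
      have hex : ∃ i : ℕ, ‖s • (x - y)‖ < 2 ^ i := pow_unbounded_of_one_lt _ (by norm_num)
      classical
      exact ⟨Nat.find hex, Nat.find_spec hex, fun j hj => not_lt.1 (Nat.find_min hex hj)⟩
    refine le_trans ?_ (ENNReal.le_tsum i)
    have hy : y ∈ Metric.ball x (2 ^ i / s) := by
      rw [Metric.mem_ball, lt_div_iff₀ hs, dist_comm, dist_eq_norm]
      rw [norm_smul, Real.norm_of_nonneg hs.le] at hi
      linarith
    rw [indicator_of_mem hy]
    gcongr ?_ * f y
    rw [mul_assoc, mul_assoc]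
    gcongr ENNReal.ofReal (s ^ n) * ?_
    refine (hK _).trans ?_
    gcongr B * ?_
    have h1 : (2 : ℝ) ^ i ≤ 2 * (1 + ‖s • (x - y)‖) := by
      rcases Nat.eq_zero_or_pos i with rfl | h
      · have := norm_nonneg (s • (x - y)); simp; linarith
      · have := hmin (i - 1) (by omega)
        have h2 : (2 : ℝ) ^ i = 2 * 2 ^ (i - 1) := by
          rw [← pow_succ']; congr 1; omega
        linarith
    have h3 : ((1 + ‖s • (x - y)‖) ^ (n + 1))⁻¹ ≤ 2 ^ (n + 1) * ((2⁻¹ : ℝ) ^ i) ^ (n + 1) := by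
      rw [← mul_pow, ← inv_pow]
      gcongr
      rw [inv_pow, ← div_eq_mul_inv, inv_le_comm₀ (by positivity) (by positivity), inv_div,
        div_le_iff₀ (by norm_num)]
      linarith
    calc _ ≤ ENNReal.ofReal (2 ^ (n + 1) * ((2⁻¹ : ℝ) ^ i) ^ (n + 1)) := ENNReal.ofReal_le_ofReal h3
      _ = _ := by
        rw [ENNReal.ofReal_mul (by positivity), ENNReal.ofReal_pow (by norm_num),
          ENNReal.ofReal_pow (by positivity), ENNReal.ofReal_pow (by positivity),
          ENNReal.ofReal_inv_of_pos (by norm_num)]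
        simp
  calc _ ≤ ∫⁻ y, ∑' i : ℕ, ENNReal.ofReal (s ^ n) * B * 2 ^ (n + 1) * ((2 : ℝ≥0∞)⁻¹ ^ i) ^ (n + 1) *
        (Metric.ball x (2 ^ i / s)).indicator f y := lintegral_mono hpt
    _ = ∑' i : ℕ, ENNReal.ofReal (s ^ n) * B * 2 ^ (n + 1) * ((2 : ℝ≥0∞)⁻¹ ^ i) ^ (n + 1) *
        ∫⁻ y in Metric.ball x (2 ^ i / s), f y := by
        rw [lintegral_tsum fun i =>
          ((hf.indicator Metric.isOpen_ball.measurableSet).const_mul _).aemeasurable]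
        congr 1; ext i
        rw [lintegral_const_mul _ (hf.indicator Metric.isOpen_ball.measurableSet),
          lintegral_indicator Metric.isOpen_ball.measurableSet]
    _ ≤ ∑' i : ℕ, 2 ^ (n + 1) * b * B * maxFn f x * (2 : ℝ≥0∞)⁻¹ ^ i := by
        refine ENNReal.tsum_le_tsum fun i => ?_
        calc _ ≤ ENNReal.ofReal (s ^ n) * B * 2 ^ (n + 1) * ((2 : ℝ≥0∞)⁻¹ ^ i) ^ (n + 1) *
              (ENNReal.ofReal ((2 ^ i / s) ^ n) * b * maxFn f x) := by
              gcongr; exact setLIntegral_ball_le_maxFn f x (by positivity)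
          _ = (ENNReal.ofReal (s ^ n) * ENNReal.ofReal ((2 ^ i / s) ^ n) * ((2 : ℝ≥0∞)⁻¹ ^ i) ^ n) *
              (2 ^ (n + 1) * b * B * maxFn f x * (2 : ℝ≥0∞)⁻¹ ^ i) := by ring
          _ = _ := by
            have : ENNReal.ofReal (s ^ n) * ENNReal.ofReal ((2 ^ i / s) ^ n) *
                ((2 : ℝ≥0∞)⁻¹ ^ i) ^ n = 1 := by
              have h2 : ((2 : ℝ≥0∞)⁻¹ ^ i) = ENNReal.ofReal (2⁻¹ ^ i) := by
                rw [ENNReal.ofReal_pow (by norm_num), ENNReal.ofReal_inv_of_pos (by norm_num)]; simp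
              rw [h2, ← ENNReal.ofReal_pow (by positivity), ← ENNReal.ofReal_mul (by positivity),
                ← ENNReal.ofReal_mul (by positivity), ← mul_pow, ← mul_pow]
              have : s * (2 ^ i / s) * 2⁻¹ ^ i = 1 := by
                rw [mul_div_cancel₀ _ hs.ne', ← mul_pow]; norm_num
              rw [this]; simp
            rw [this, one_mul]
    _ = _ := by
        rw [ENNReal.tsum_mul_left, ENNReal.tsum_geometric, ENNReal.one_sub_inv_two, inv_inv]
        ring

/-- The Fourier multiplier operator with symbol `m`, in Mathlib's normalisation. -/
def mulOp (m : V n → ℂ) (f : 𝓢(V n, ℂ)) (x : V n) : ℂ :=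
  𝓕⁻ (fun η => m η * 𝓕 (f : V n → ℂ) η) x

lemma FT_two_pi_smul (f : V n → ℂ) (η : V n) : FT f ((2 * Real.pi) • η) = 𝓕 f η := by
  rw [FT, Real.fourier_eq']
  congr 1
  ext y
  rw [smul_eq_mul, inner_smul_right]
  congr 2
  push_cast
  ring

lemma scaled_integral_eq_fourierInv (Φ : V n → ℂ) (x : V n) :
    ((((2 * Real.pi) ^ n)⁻¹ : ℝ) : ℂ) *
      ∫ ξ : V n, Complex.exp (Complex.I * ((⟪x, ξ⟫ : ℝ) : ℂ)) * Φ ξ =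
    𝓕⁻ (fun η => Φ ((2 * Real.pi) • η)) x := by
  have h := Measure.integral_comp_smul (volume : Measure (V n))
    (fun ξ : V n => Complex.exp (Complex.I * ((⟪x, ξ⟫ : ℝ) : ℂ)) * Φ ξ) (2 * Real.pi)
  rw [finrank_euclideanSpace, Fintype.card_fin, abs_of_pos (by positivity)] at h
  rw [Real.fourierInv_eq', ← Complex.real_smul, ← h]
  congr 1
  ext η
  rw [smul_eq_mul, inner_smul_right, real_inner_comm]
  congr 2
  push_cast
  ring

lemma scaled_integral_eq_fourierInv_mul (c : V n → ℂ) (f : V n → ℂ) (x : V n) :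
    ((((2 * Real.pi) ^ n)⁻¹ : ℝ) : ℂ) *
      ∫ ξ : V n, Complex.exp (Complex.I * ((⟪x, ξ⟫ : ℝ) : ℂ)) * c ξ * FT f ξ =
    𝓕⁻ (fun η => c ((2 * Real.pi) • η) * 𝓕 f η) x := by
  simp_rw [mul_assoc]
  rw [scaled_integral_eq_fourierInv (fun ξ => c ξ * FT f ξ)]
  simp_rw [FT_two_pi_smul]

lemma norm_two_pi_smul (η : V n) : ‖(2 * Real.pi) • η‖ = 2 * Real.pi * ‖η‖ := by
  rw [norm_smul, Real.norm_of_nonneg (by positivity)]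

lemma bochnerRiesz_eq_mulOp (δ t : ℝ) (f : 𝓢(V n, ℂ)) (x : V n) :
    bochnerRiesz δ t f x =
      mulOp (fun η => ((posRpow (1 - t * (2 * Real.pi) * ‖η‖) δ : ℝ) : ℂ)) f x := by
  rw [bochnerRiesz, scaled_integral_eq_fourierInv_mul
    (fun ξ => ((posRpow (1 - t * ‖ξ‖) δ : ℝ) : ℂ)), mulOp]
  simp_rw [norm_two_pi_smul, mul_assoc]

lemma besselD_eq (s : ℝ) (g : V n → ℂ) (x : V n) :
    besselD s g x =
      𝓕⁻ (fun η => (((1 + (2 * Real.pi * ‖η‖) ^ 2) ^ (s / 2) : ℝ) : ℂ) * 𝓕 g η) x := by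
  rw [besselD, scaled_integral_eq_fourierInv_mul
    (fun ξ => (((1 + ‖ξ‖ ^ 2) ^ (s / 2) : ℝ) : ℂ))]
  simp_rw [norm_two_pi_smul]

/-- The symbol of the half-wave propagator, in Mathlib's normalisation. -/
def wave (t : ℝ) (η : V n) : ℂ := Complex.exp ((2 * Real.pi * t * ‖η‖ : ℝ) * Complex.I)

lemma halfWave_eq_mulOp (t : ℝ) (f : 𝓢(V n, ℂ)) (x : V n) :
    halfWave t f x = mulOp (wave t) f x := by
  have h : ∀ ξ : V n, Complex.exp (Complex.I * (((⟪x, ξ⟫ + t * ‖ξ‖ : ℝ)) : ℂ)) * FT f ξ =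
      Complex.exp (Complex.I * ((⟪x, ξ⟫ : ℝ) : ℂ)) *
        Complex.exp (Complex.I * ((t * ‖ξ‖ : ℝ) : ℂ)) * FT f ξ := fun ξ => by
    rw [← Complex.exp_add]
    push_cast
    ring_nf
  rw [halfWave]
  simp_rw [h]
  rw [scaled_integral_eq_fourierInv_mul
    (fun ξ => Complex.exp (Complex.I * ((t * ‖ξ‖ : ℝ) : ℂ))), mulOp]
  refine congrArg (fun F : V n → ℂ => 𝓕⁻ F x) (funext fun η => ?_)
  rw [norm_two_pi_smul, wave]
  congr 2
  push_cast
  ring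

@[simp] lemma norm_wave (t : ℝ) (η : V n) : ‖wave t η‖ = 1 := Complex.norm_exp_ofReal_mul_I _

lemma continuous_wave_uncurry : Continuous (fun q : ℝ × V n => wave q.1 q.2) := by
  unfold wave
  fun_prop

lemma integrable_fourier (f : 𝓢(V n, ℂ)) : Integrable (𝓕 (f : V n → ℂ)) := by
  rw [← SchwartzMap.fourier_coe]
  exact (𝓕 f).integrable

lemma continuous_fourier (f : 𝓢(V n, ℂ)) : Continuous (𝓕 (f : V n → ℂ)) := by
  rw [← SchwartzMap.fourier_coe]
  exact (𝓕 f).continuous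

lemma fourierInv_mul_fourier_eq_integral {m f : V n → ℂ} (hm : Integrable m)
    (hf : Integrable f) (x : V n) :
    𝓕⁻ (fun η => m η * 𝓕 f η) x = ∫ y, 𝓕⁻ m (x - y) * f y := by
  have hg : Integrable (fun η : V n => Real.fourierChar (⟪η, x⟫ : ℝ) • m η) := by
    have := (Real.fourierIntegral_convergent_iff (μ := volume) (f := m) (-x)).2 hm
    simpa using this
  have key := VectorFourier.integral_fourierIntegral_smul_eq_flip
    (e := Real.fourierChar) (L := innerₗ (V n)) (μ := volume) (ν := volume)
    (f := f) (g := fun η : V n => Real.fourierChar (⟪η, x⟫ : ℝ) • m η)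
    Real.continuous_fourierChar (by simpa using continuous_inner) hf hg
  have e1 : 𝓕⁻ (fun η => m η * 𝓕 f η) x =
      ∫ ξ, (VectorFourier.fourierIntegral Real.fourierChar volume (innerₗ (V n)) f ξ) •
        (Real.fourierChar (⟪ξ, x⟫ : ℝ) • m ξ) := by
    rw [Real.fourierInv_eq]
    congr 1
    ext η
    change _ = 𝓕 f η • _
    simp only [Circle.smul_def, smul_eq_mul]
    ring
  rw [e1, key]
  congr 1
  ext y
  rw [smul_eq_mul, mul_comm]
  congr 1
  rw [Real.fourierInv_eq]
  simp only [VectorFourier.fourierIntegral]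
  congr 1
  ext η
  simp only [Circle.smul_def, smul_eq_mul, ← mul_assoc, ← Circle.coe_mul, ← AddChar.map_add_eq_mul]
  congr 3
  simp [inner_sub_right, real_inner_comm]
  ring

lemma fourierInv_comp_smul (m : V n → ℂ) {s : ℝ} (hs : 0 < s) (x : V n) :
    𝓕⁻ (fun η => m (s • η)) x = ((s⁻¹ ^ n : ℝ) : ℂ) * 𝓕⁻ m (s⁻¹ • x) := by
  rw [Real.fourierInv_eq, Real.fourierInv_eq]
  have h := Measure.integral_comp_smul (volume : Measure (V n))
    (fun η : V n => Real.fourierChar (⟪η, s⁻¹ • x⟫ : ℝ) • m η) s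
  rw [finrank_euclideanSpace, Fintype.card_fin, abs_of_pos (by positivity)] at h
  rw [inv_pow, ← Complex.real_smul, ← h]
  congr 1
  ext η
  rw [real_inner_smul_left, real_inner_smul_right, ← mul_assoc, mul_inv_cancel₀ hs.ne', one_mul]

lemma enorm_mulOp_le_maxFn : ∃ C : ℝ≥0∞, C ≠ ⊤ ∧ ∀ (m : V n → ℂ) (B : ℝ),
    Integrable m → (∀ x, ‖𝓕⁻ m x‖ ≤ B * ((1 + ‖x‖) ^ (n + 1))⁻¹) → ∀ s : ℝ, 0 < s →
    ∀ (f : 𝓢(V n, ℂ)) (x : V n),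
      ‖mulOp (fun η => m (s • η)) f x‖ₑ ≤ C * ENNReal.ofReal B * maxFn (fun y => ‖f y‖ₑ) x := by
  obtain ⟨C, hC, h⟩ := lintegral_kernel_le_maxFn (n := n)
  refine ⟨C, hC, fun m B hm hB s hs f x => ?_⟩
  have hms : Integrable (fun η => m (s • η)) := (integrable_comp_smul_iff volume m hs.ne').2 hm
  have hB0 : 0 ≤ B := by
    have := (norm_nonneg _).trans (hB 0)
    simpa using this
  rw [mulOp, fourierInv_mul_fourier_eq_integral hms f.integrable]
  refine (enorm_integral_le_lintegral_enorm _).trans ?_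
  refine le_trans (lintegral_mono fun y => ?_)
    (h (fun y => ‖𝓕⁻ m y‖ₑ) (ENNReal.ofReal B) (fun y => ?_) s⁻¹ (by positivity)
      (fun y => ‖f y‖ₑ) (by fun_prop) x)
  · rw [fourierInv_comp_smul m hs, enorm_mul, enorm_mul]
    gcongr
    rw [← ofReal_norm, Complex.norm_real, Real.norm_of_nonneg (by positivity)]
  · rw [← ENNReal.ofReal_mul hB0, ← ofReal_norm]
    exact ENNReal.ofReal_le_ofReal (hB y)

lemma mulOp_comp_smul (m : V n → ℂ) (f g : 𝓢(V n, ℂ)) {s : ℝ} (hs : 0 < s)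
    (hg : ∀ x, g x = f (s • x)) (x : V n) :
    mulOp m g x = mulOp (fun η => m (s • η)) f (s • x) := by
  have hF : ∀ η, 𝓕 (g : V n → ℂ) (s • η) = ((s⁻¹ ^ n : ℝ) : ℂ) * 𝓕 (f : V n → ℂ) η := by
    intro η
    have : (g : V n → ℂ) = fun x => f (s • x) := funext hg
    have e := fourierInv_comp_smul (f : V n → ℂ) hs (-(s • η))
    rw [smul_neg, smul_smul, inv_mul_cancel₀ hs.ne', one_smul] at e
    rw [this]
    simpa [Real.fourierInv_eq_fourier_neg] using e
  have h := fourierInv_comp_smul (fun η => m η * 𝓕 (g : V n → ℂ) η) hs (s • x)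
  rw [smul_smul, inv_mul_cancel₀ hs.ne', one_smul] at h
  simp_rw [hF] at h
  rw [mulOp, mulOp]
  have hne : ((s⁻¹ ^ n : ℝ) : ℂ) ≠ 0 := by
    exact_mod_cast (by positivity : (s⁻¹ ^ n : ℝ) ≠ 0)
  apply mul_left_cancel₀ hne
  rw [← h, Real.fourierInv_eq, Real.fourierInv_eq, ← smul_eq_mul, ← integral_smul]
  congr 1
  ext η
  simp only [Circle.smul_def, smul_eq_mul]
  ring

lemma exists_norm_fourierInv_le {A : ℝ × V n → ℂ} (hA : ContDiff ℝ ∞ A)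
    (hc : HasCompactSupport A) (N : ℕ) :
    ∃ C : ℝ, 0 ≤ C ∧ ∀ e x, ‖𝓕⁻ (fun ξ => A (e, ξ)) x‖ ≤ C * ((1 + ‖x‖) ^ N)⁻¹ := by
  obtain ⟨R, hR0, hR⟩ : ∃ R : ℝ, 0 < R ∧ tsupport A ⊆ Metric.closedBall 0 R := by
    obtain ⟨R, hR⟩ := hc.isCompact.isBounded.subset_closedBall 0
    exact ⟨max R 1, by positivity, hR.trans (Metric.closedBall_subset_closedBall (le_max_left _ _))⟩
  have hM : ∀ j : ℕ, ∃ M : ℝ, 0 ≤ M ∧ ∀ q, ‖iteratedFDeriv ℝ j A q‖ ≤ M := fun j => by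
    obtain ⟨M, hM⟩ := (hc.iteratedFDeriv (𝕜 := ℝ) j).exists_bound_of_continuous
      (hA.continuous_iteratedFDeriv (m := j) (by exact_mod_cast le_top))
    exact ⟨M, (norm_nonneg _).trans (hM 0), hM⟩
  choose M hM0 hM using hM
  have hslice : ∀ e : ℝ, ContDiff ℝ ∞ (fun ξ => A (e, ξ)) := fun e => by fun_prop
  have hder : ∀ (j : ℕ) (e : ℝ) (ξ : V n), ‖iteratedFDeriv ℝ j (fun ξ => A (e, ξ)) ξ‖ ≤
      (Metric.closedBall (0 : V n) R).indicator (fun _ => M j) ξ := by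
    intro j e ξ
    have e1 : (fun ξ => A (e, ξ)) =
        (fun q => A ((e, 0) + q)) ∘ (ContinuousLinearMap.inr ℝ ℝ (V n)) := by
      ext ξ; simp
    have hA' : ContDiff ℝ ∞ (fun q => A ((e, 0) + q)) := by fun_prop
    have e2 : iteratedFDeriv ℝ j (fun ξ => A (e, ξ)) ξ =
        (iteratedFDeriv ℝ j A (e, ξ)).compContinuousLinearMap
          (fun _ => ContinuousLinearMap.inr ℝ ℝ (V n)) := by
      rw [e1, ContinuousLinearMap.iteratedFDeriv_comp_right _ hA' ξ (i := j)
        (by exact_mod_cast le_top), iteratedFDeriv_comp_add_left]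
      simp
    have hle : ‖iteratedFDeriv ℝ j (fun ξ => A (e, ξ)) ξ‖ ≤ ‖iteratedFDeriv ℝ j A (e, ξ)‖ := by
      rw [e2]
      refine (ContinuousMultilinearMap.norm_compContinuousLinearMap_le _ _).trans ?_
      refine mul_le_of_le_one_right (norm_nonneg _) (Finset.prod_le_one (fun _ _ => norm_nonneg _)
        fun _ _ => ContinuousLinearMap.norm_inr_le_one _ _ _)
    by_cases hξ : ξ ∈ Metric.closedBall (0 : V n) R
    · rw [indicator_of_mem hξ]
      exact hle.trans (hM j _)
    · rw [indicator_of_notMem hξ]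
      refine hle.trans ?_
      have : iteratedFDeriv ℝ j A (e, ξ) = 0 := by
        apply image_eq_zero_of_notMem_tsupport
        intro h
        have h2 := hR (tsupport_iteratedFDeriv_subset j h)
        apply hξ
        rw [mem_closedBall_zero_iff] at h2 ⊢
        exact (le_max_right _ _).trans h2
      rw [this, norm_zero]
  have hiB : ∀ j, Integrable ((Metric.closedBall (0 : V n) R).indicator (fun _ => M j)) :=
    fun j => (integrable_indicator_iff measurableSet_closedBall).2
      (integrableOn_const (measure_closedBall_lt_top.ne))
  have hcont : ∀ (j : ℕ) e, Continuous (fun ξ => iteratedFDeriv ℝ j (fun ξ => A (e, ξ)) ξ) :=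
    fun j e => (hslice e).continuous_iteratedFDeriv (m := j) (by exact_mod_cast le_top)
  have h_int : ∀ (j : ℕ) e, Integrable (fun ξ => ‖iteratedFDeriv ℝ j (fun ξ => A (e, ξ)) ξ‖) :=
    fun j e => (hiB j).mono' (hcont j e).norm.aestronglyMeasurable
      (Eventually.of_forall fun ξ => by simpa using hder j e ξ)
  set I : ℕ → ℝ := fun j => ∫ ξ, (Metric.closedBall (0 : V n) R).indicator (fun _ => M j) ξ with hI
  have hI0 : ∀ j, 0 ≤ I j := fun j => integral_nonneg fun ξ => indicator_nonneg (fun _ _ => hM0 j) _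
  have hle : ∀ (j : ℕ) e, ∫ ξ, ‖iteratedFDeriv ℝ j (fun ξ => A (e, ξ)) ξ‖ ≤ I j := fun j e =>
    integral_mono (h_int j e) (hiB j) (hder j e)
  have hpow : ∀ (m : ℕ), m ≤ N → ∀ e w, ‖w‖ ^ m * ‖𝓕 (fun ξ => A (e, ξ)) w‖ ≤
      2 ^ m * ∑ j ∈ Finset.range (N + 1), I j := by
    intro m hm e w
    have h := Real.pow_mul_norm_iteratedFDeriv_fourier_le (K := 0) (N := N)
      ((hslice e).of_le (by exact_mod_cast le_top)) (fun k j hk hj => by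
        obtain rfl : k = 0 := by exact_mod_cast nonpos_iff_eq_zero.1 hk
        simpa using h_int j e) (k := 0) (n := m) le_rfl (by exact_mod_cast hm) w
    simp only [norm_iteratedFDeriv_zero, pow_zero, Nat.cast_zero, mul_zero, zero_add, one_mul,
      Finset.range_one] at h
    refine h.trans ?_
    gcongr
    rw [Finset.sum_product, Finset.sum_singleton]
    simp only [pow_zero, one_mul]
    calc ∑ j ∈ Finset.range (m + 1), ∫ v, ‖iteratedFDeriv ℝ j (fun ξ => A (e, ξ)) v‖
        ≤ ∑ j ∈ Finset.range (m + 1), I j := Finset.sum_le_sum fun j _ => hle j e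
      _ ≤ ∑ j ∈ Finset.range (N + 1), I j :=
        Finset.sum_le_sum_of_subset_of_nonneg (Finset.range_mono (by omega)) fun j _ _ => hI0 j
  set S := ∑ j ∈ Finset.range (N + 1), I j with hS
  have hS0 : 0 ≤ S := Finset.sum_nonneg fun j _ => hI0 j
  refine ⟨2 ^ N * (S + 2 ^ N * S), by positivity, fun e x => ?_⟩
  rw [Real.fourierInv_eq_fourier_neg, ← div_eq_mul_inv, le_div_iff₀ (by positivity)]
  have h0 := hpow 0 (Nat.zero_le _) e (-x)
  have h1 := hpow N le_rfl e (-x)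
  rw [norm_neg] at h0 h1
  have h2 : (1 + ‖x‖) ^ N ≤ 2 ^ N * (1 + ‖x‖ ^ N) := by
    rcases le_total ‖x‖ 1 with h | h
    · calc (1 + ‖x‖) ^ N ≤ 2 ^ N := by gcongr; linarith
        _ ≤ _ := le_mul_of_one_le_right (by positivity) (by simp)
    · calc (1 + ‖x‖) ^ N ≤ (2 * ‖x‖) ^ N := by gcongr; linarith
        _ ≤ _ := by rw [mul_pow]; gcongr; simp
  calc ‖𝓕 (fun ξ => A (e, ξ)) (-x)‖ * (1 + ‖x‖) ^ N
      ≤ ‖𝓕 (fun ξ => A (e, ξ)) (-x)‖ * (2 ^ N * (1 + ‖x‖ ^ N)) := by gcongr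
    _ = 2 ^ N * (‖x‖ ^ 0 * ‖𝓕 (fun ξ => A (e, ξ)) (-x)‖ +
          ‖x‖ ^ N * ‖𝓕 (fun ξ => A (e, ξ)) (-x)‖) := by ring
    _ ≤ 2 ^ N * (2 ^ 0 * S + 2 ^ N * S) := by gcongr
    _ = _ := by ring

lemma contDiff_radial {a : ℝ × ℝ → ℂ} (ha : ContDiff ℝ ∞ a) {r₀ : ℝ} (hr₀ : 0 < r₀)
    (hflat : ∀ e r, r < r₀ → a (e, r) = a (e, 0)) :
    ContDiff ℝ ∞ (fun q : ℝ × V n => a (q.1, ‖q.2‖)) := by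
  rw [contDiff_iff_contDiffAt]
  rintro ⟨e, ξ⟩
  by_cases hξ : ξ = 0
  · have h1 : ContDiffAt ℝ ∞ (fun q : ℝ × V n => a (q.1, 0)) (e, ξ) := by fun_prop
    refine h1.congr_of_eventuallyEq ?_
    have : ∀ᶠ q : ℝ × V n in 𝓝 (e, ξ), ‖q.2‖ < r₀ :=
      (continuous_snd.norm.tendsto (e, ξ)).eventually_lt_const (by simpa [hξ] using hr₀)
    filter_upwards [this] with q hq using hflat _ _ hq
  · exact ContDiffAt.comp (e, ξ) (g := a) ha.contDiffAt
      (contDiffAt_fst.prodMk (contDiffAt_snd.norm ℝ hξ))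

lemma hasCompactSupport_radial {a : ℝ × ℝ → ℂ} {R : ℝ}
    (hR : ∀ e r, R < |e| ∨ R < r → a (e, r) = 0) :
    HasCompactSupport (fun q : ℝ × V n => a (q.1, ‖q.2‖)) := by
  refine HasCompactSupport.intro (isCompact_closedBall (0 : ℝ × V n) R) fun q hq => ?_
  rw [mem_closedBall_zero_iff, not_le] at hq
  exact hR _ _ (lt_max_iff.1 hq)

/-- Radial multipliers with a compact parameter space are controlled by the maximal function. -/
lemma exists_enorm_mulOp_radial_le {a : ℝ × ℝ → ℂ} (ha : ContDiff ℝ ∞ a) {r₀ : ℝ} (hr₀ : 0 < r₀)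
    (hflat : ∀ e r, r < r₀ → a (e, r) = a (e, 0)) {R : ℝ}
    (hR : ∀ e r, R < |e| ∨ R < r → a (e, r) = 0) :
    ∃ C : ℝ≥0∞, C ≠ ⊤ ∧ ∀ (e s : ℝ), 0 < s → ∀ (f : 𝓢(V n, ℂ)) (x : V n),
      ‖mulOp (fun η => a (e, s * ‖η‖)) f x‖ₑ ≤ C * maxFn (fun y => ‖f y‖ₑ) x := by
  obtain ⟨C, hC, h⟩ := enorm_mulOp_le_maxFn (n := n)
  have hA := contDiff_radial (n := n) ha hr₀ hflat
  have hc := hasCompactSupport_radial (n := n) hR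
  obtain ⟨B, hB0, hB⟩ := exists_norm_fourierInv_le hA hc (n + 1)
  refine ⟨C * ENNReal.ofReal B, ENNReal.mul_ne_top hC ENNReal.ofReal_ne_top,
    fun e s hs f x => ?_⟩
  have h_int : Integrable (fun ξ : V n => a (e, ‖ξ‖)) := by
    refine Continuous.integrable_of_hasCompactSupport ?_ ?_
    · exact hA.continuous.comp (Continuous.prodMk_right e)
    · refine HasCompactSupport.intro (isCompact_closedBall (0 : V n) R) fun ξ hξ => ?_
      rw [mem_closedBall_zero_iff, not_le] at hξ
      exact hR _ _ (Or.inr hξ)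
  have := h (fun ξ => a (e, ‖ξ‖)) B h_int (fun x => hB e x) s hs f x
  simpa only [norm_smul, Real.norm_of_nonneg hs.le] using this

/-- A smooth decreasing cutoff, equal to `1` on `(-∞, 1/4]` and to `0` on `[1/2, ∞)`. -/
def cut (r : ℝ) : ℝ := Real.smoothTransition (2 - 4 * r)

lemma cut_eq_one {r : ℝ} (h : r ≤ 1 / 4) : cut r = 1 :=
  Real.smoothTransition.one_of_one_le (by linarith)

lemma cut_eq_zero {r : ℝ} (h : 1 / 2 ≤ r) : cut r = 0 :=
  Real.smoothTransition.zero_of_nonpos (by linarith)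

lemma cut_nonneg (r : ℝ) : 0 ≤ cut r := Real.smoothTransition.nonneg _

lemma cut_le_one (r : ℝ) : cut r ≤ 1 := Real.smoothTransition.le_one _

lemma contDiff_cut : ContDiff ℝ ∞ cut :=
  Real.smoothTransition.contDiff.comp (contDiff_const.sub (contDiff_const.mul contDiff_id))

@[fun_prop]
lemma continuous_cut : Continuous cut := contDiff_cut.continuous

/-- A smooth bump equal to `1` on `[-1, 1]` and supported in `[-2, 2]`. -/
def bump (e : ℝ) : ℝ := cut (e ^ 2 / 4)

lemma bump_eq_one {e : ℝ} (h : |e| ≤ 1) : bump e = 1 :=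
  cut_eq_one (by have := abs_le_one_iff_mul_self_le_one.1 h; nlinarith)

lemma bump_eq_zero {e : ℝ} (h : 2 < |e|) : bump e = 0 :=
  cut_eq_zero (by have := sq_abs e; nlinarith)

lemma contDiff_bump : ContDiff ℝ ∞ bump :=
  contDiff_cut.comp ((contDiff_id.pow 2).div_const 4)

/-- A smooth annular cutoff, equal to `1` on `[1/64, 2]` and supported in `[1/128, 4]`. -/
def ann (r : ℝ) : ℝ := cut (r / 8) - cut (32 * r)

lemma ann_eq_one {r : ℝ} (h1 : 1 / 64 ≤ r) (h2 : r ≤ 2) : ann r = 1 := by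
  rw [ann, cut_eq_one (by linarith), cut_eq_zero (by linarith), sub_zero]

lemma ann_eq_zero_of_lt {r : ℝ} (h : r ≤ 1 / 128) : ann r = 0 := by
  rw [ann, cut_eq_one (by linarith), cut_eq_one (by linarith), sub_self]

lemma ann_eq_zero_of_gt {r : ℝ} (h : 4 ≤ r) : ann r = 0 := by
  rw [ann, cut_eq_zero (by linarith), cut_eq_zero (by linarith), sub_self]

lemma abs_ann_le_one (r : ℝ) : |ann r| ≤ 1 := by
  have h1 := cut_nonneg (r / 8)
  have h2 := cut_le_one (r / 8)
  have h3 := cut_nonneg (32 * r)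
  have h4 := cut_le_one (32 * r)
  rw [ann, abs_le]
  constructor <;> linarith

lemma contDiff_ann : ContDiff ℝ ∞ ann :=
  (contDiff_cut.comp (contDiff_id.div_const 8)).sub
    (contDiff_cut.comp (contDiff_const.mul contDiff_id))

@[fun_prop]
lemma continuous_ann : Continuous ann := contDiff_ann.continuous

lemma exists_enorm_mulOp_radial_le_single {b : ℝ → ℂ} (hb : ContDiff ℝ ∞ b) {r₀ : ℝ} (hr₀ : 0 < r₀)
    (hflat : ∀ r, r < r₀ → b r = b 0) {R : ℝ} (hR : ∀ r, R < r → b r = 0) :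
    ∃ C : ℝ≥0∞, C ≠ ⊤ ∧ ∀ s : ℝ, 0 < s → ∀ (f : 𝓢(V n, ℂ)) (x : V n),
      ‖mulOp (fun η => b (s * ‖η‖)) f x‖ₑ ≤ C * maxFn (fun y => ‖f y‖ₑ) x := by
  obtain ⟨C, hC, h⟩ := exists_enorm_mulOp_radial_le (n := n)
    (a := fun q => (bump q.1 : ℂ) * b q.2) (R := max R 2) (r₀ := r₀)
    ((Complex.ofRealCLM.contDiff.comp (contDiff_bump.comp contDiff_fst)).mul
      (hb.comp contDiff_snd)) hr₀ (fun e r hr => by simp only [hflat r hr])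
    (by
      rintro e r (h | h)
      · simp [bump_eq_zero ((le_max_right _ _).trans_lt h)]
      · simp [hR r ((le_max_left _ _).trans_lt h)])
  refine ⟨C, hC, fun s hs f x => ?_⟩
  have := h 0 s hs f x
  simpa [bump_eq_one] using this

lemma exists_schwartz_mulOp {m : V n → ℂ} (hm : ContDiff ℝ ∞ m) (hc : HasCompactSupport m)
    (f : 𝓢(V n, ℂ)) :
    ∃ g : 𝓢(V n, ℂ), (∀ x, g x = mulOp m f x) ∧
      ∀ η, 𝓕 (g : V n → ℂ) η = m η * 𝓕 (f : V n → ℂ) η := by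
  have hc' : HasCompactSupport (fun η => m η * (𝓕 f) η) := hc.mul_right
  have hm' : ContDiff ℝ ∞ (fun η => m η * (𝓕 f) η) := hm.mul ((𝓕 f).smooth _)
  refine ⟨𝓕⁻ (hc'.toSchwartzMap hm'), fun x => ?_, fun η => ?_⟩
  · rw [SchwartzMap.fourierInv_coe]
    rfl
  · rw [← SchwartzMap.fourier_coe, FourierTransform.fourier_fourierInv_eq]
    rfl

lemma lintegral_enorm_sq_fourier (f : 𝓢(V n, ℂ)) :
    ∫⁻ η, ‖𝓕 (f : V n → ℂ) η‖ₑ ^ 2 = ∫⁻ x, ‖f x‖ₑ ^ 2 := by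
  have key : ∀ g : 𝓢(V n, ℂ), ∫⁻ x, ‖g x‖ₑ ^ 2 = ENNReal.ofReal (∫ x, ‖g x‖ ^ 2) := fun g => by
    rw [ofReal_integral_eq_lintegral_ofReal]
    · congr 1
      ext x
      rw [← ofReal_norm, ENNReal.ofReal_pow (norm_nonneg _)]
    · exact (g.memLp 2).integrable_norm_pow (by norm_num)
    · exact Eventually.of_forall fun x => by positivity
  rw [key, ← SchwartzMap.integral_norm_sq_fourier, ← SchwartzMap.fourier_coe]
  exact key (𝓕 f)

lemma contDiff_ann_radial {s : ℝ} (hs : 0 < s) :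
    ContDiff ℝ ∞ (fun η : V n => (ann (s * ‖η‖) : ℂ)) := by
  have h1 : ContDiff ℝ ∞ (fun q : ℝ × ℝ => (ann (s * q.2) : ℂ)) :=
    Complex.ofRealCLM.contDiff.comp (contDiff_ann.comp (contDiff_const.mul contDiff_snd))
  have hflat : ∀ e r : ℝ, r < 1 / 128 / s →
      (fun q : ℝ × ℝ => (ann (s * q.2) : ℂ)) (e, r) =
        (fun q : ℝ × ℝ => (ann (s * q.2) : ℂ)) (e, 0) := by
    intro e r hr
    rw [lt_div_iff₀' hs] at hr
    have h0 : s * 0 ≤ 1 / 128 := by norm_num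
    change ((ann (s * r) : ℝ) : ℂ) = ((ann (s * 0) : ℝ) : ℂ)
    rw [ann_eq_zero_of_lt hr.le, ann_eq_zero_of_lt h0]
  have h := contDiff_radial (n := n) h1 (by positivity) hflat
  have h2 : ContDiff ℝ ∞ (fun η : V n => ((0 : ℝ), η)) := contDiff_prodMk_right (0 : ℝ)
  have h3 := h.comp h2
  simpa only [Function.comp_def] using h3

lemma hasCompactSupport_ann_radial {s : ℝ} (hs : 0 < s) :
    HasCompactSupport (fun η : V n => (ann (s * ‖η‖) : ℂ)) := by
  refine HasCompactSupport.intro (isCompact_closedBall (0 : V n) (4 / s)) fun ξ hξ => ?_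
  rw [mem_closedBall_zero_iff, not_le, div_lt_iff₀' hs] at hξ
  rw [ann_eq_zero_of_gt hξ.le, Complex.ofReal_zero]

lemma tsum_ann_sq_le (r : ℝ) : ∑' k : ℤ, ‖((ann (2 ^ k * r) : ℝ) : ℂ)‖ₑ ^ 2 ≤ 11 := by
  have hle : ∀ k : ℤ, ‖((ann (2 ^ k * r) : ℝ) : ℂ)‖ₑ ^ 2 ≤ 1 := fun k => by
    apply pow_le_one'
    rw [← ofReal_norm, Complex.norm_real, Real.norm_eq_abs]
    exact ENNReal.ofReal_le_one.2 (abs_ann_le_one _)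
  rcases le_or_gt r 0 with hr | hr
  · have : ∀ k : ℤ, ‖((ann (2 ^ k * r) : ℝ) : ℂ)‖ₑ ^ 2 = 0 := fun k => by
      have : (2 : ℝ) ^ k * r ≤ 0 := mul_nonpos_of_nonneg_of_nonpos (by positivity) hr
      rw [ann_eq_zero_of_lt (by linarith)]
      simp
    simp [this]
  obtain ⟨j, hj1, hj2⟩ := exists_mem_Ico_zpow hr one_lt_two
  rw [tsum_eq_sum (s := Finset.Icc (-j - 8) (-j + 2))]
  · refine (Finset.sum_le_sum fun k _ => hle k).trans ?_
    rw [Finset.sum_const, Int.card_Icc, show -j + 2 + 1 - (-j - 8) = 11 by ring]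
    norm_num
  · intro k hk
    have : ann (2 ^ k * r) = 0 := by
      rw [Finset.mem_Icc, not_and_or, not_le, not_le] at hk
      rcases hk with hk | hk
      · apply ann_eq_zero_of_lt
        calc (2 : ℝ) ^ k * r ≤ 2 ^ k * 2 ^ (j + 1) := by gcongr
          _ = 2 ^ (k + (j + 1)) := (zpow_add₀ two_ne_zero _ _).symm
          _ ≤ 2 ^ (-7 : ℤ) := zpow_le_zpow_right₀ one_le_two (by omega)
          _ = 1 / 128 := by norm_num
      · apply ann_eq_zero_of_gt
        calc (4 : ℝ) = 2 ^ (2 : ℤ) := by norm_num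
          _ ≤ 2 ^ (k + j) := zpow_le_zpow_right₀ one_le_two (by omega)
          _ = 2 ^ k * 2 ^ j := zpow_add₀ two_ne_zero _ _
          _ ≤ _ := by gcongr
    simp [this]

/-- The dyadic Littlewood–Paley piece of `f` at frequency `2 ^ (-k)`. -/
def lpPiece (k : ℤ) (f : 𝓢(V n, ℂ)) (x : V n) : ℂ :=
  mulOp (fun η => (ann (2 ^ k * ‖η‖) : ℂ)) f x

lemma tsum_lintegral_lpPiece_sq_le (u : 𝓢(V n, ℂ)) :
    ∑' k : ℤ, ∫⁻ x, ‖lpPiece k u x‖ₑ ^ 2 ≤ 11 * ∫⁻ x, ‖u x‖ₑ ^ 2 := by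
  have h : ∀ k : ℤ, ∫⁻ x, ‖lpPiece k u x‖ₑ ^ 2 =
      ∫⁻ η, ‖((ann (2 ^ k * ‖η‖) : ℝ) : ℂ)‖ₑ ^ 2 * ‖𝓕 (u : V n → ℂ) η‖ₑ ^ 2 := fun k => by
    obtain ⟨g, hg1, hg2⟩ := exists_schwartz_mulOp
      (contDiff_ann_radial (n := n) (s := 2 ^ k) (by positivity))
      (hasCompactSupport_ann_radial (by positivity)) u
    simp_rw [lpPiece, ← hg1]
    rw [← lintegral_enorm_sq_fourier]
    simp_rw [hg2, enorm_mul, mul_pow]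
  simp_rw [h]
  have hcF := continuous_fourier u
  rw [← lintegral_tsum fun k => by fun_prop]
  simp_rw [ENNReal.tsum_mul_right]
  rw [← lintegral_enorm_sq_fourier, ← lintegral_const_mul' _ _ (by norm_num)]
  gcongr
  exact tsum_ann_sq_le _

lemma continuous_mulOp {m : V n → ℂ} {B : ℝ} (hm : AEStronglyMeasurable m)
    (hB : ∀ η, ‖m η‖ ≤ B) (f : 𝓢(V n, ℂ)) : Continuous (mulOp m f) := by
  have hi : Integrable (fun η => m η * 𝓕 (f : V n → ℂ) η) :=
    (integrable_fourier f).bdd_mul hm (Eventually.of_forall hB)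
  have : mulOp m f = fun x => 𝓕 (fun η => m η * 𝓕 (f : V n → ℂ) η) (-x) := by
    ext x
    rw [mulOp, Real.fourierInv_eq_fourier_neg]
  rw [this]
  exact (VectorFourier.fourierIntegral_continuous Real.continuous_fourierChar
    (by simpa using continuous_inner) hi).comp continuous_neg

lemma continuous_lpPiece (k : ℤ) (f : 𝓢(V n, ℂ)) : Continuous (lpPiece k f) :=
  continuous_mulOp (B := 1) (by fun_prop) (fun η => by
    rw [Complex.norm_real]; exact abs_ann_le_one _) f

lemma lpPiece_add (k : ℤ) (u v : 𝓢(V n, ℂ)) (x : V n) :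
    lpPiece k (u + v) x = lpPiece k u x + lpPiece k v x := by
  have hF : ∀ η, 𝓕 ((u + v : 𝓢(V n, ℂ)) : V n → ℂ) η =
      𝓕 (u : V n → ℂ) η + 𝓕 (v : V n → ℂ) η := by
    intro η
    rw [← SchwartzMap.fourier_coe, FourierTransform.fourier_add]
    rfl
  have hi : ∀ w : 𝓢(V n, ℂ), Integrable (fun η : V n => Real.fourierChar (⟪η, x⟫ : ℝ) •
      (((ann (2 ^ k * ‖η‖) : ℝ) : ℂ) * 𝓕 (w : V n → ℂ) η)) := fun w => by
    have h0 : Integrable (fun η : V n =>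
        ((ann (2 ^ k * ‖η‖) : ℝ) : ℂ) * 𝓕 (w : V n → ℂ) η) :=
      (integrable_fourier w).bdd_mul (c := 1) (Continuous.aestronglyMeasurable (by fun_prop))
        (Eventually.of_forall fun η => by rw [Complex.norm_real]; exact abs_ann_le_one _)
    have := (Real.fourierIntegral_convergent_iff (μ := volume) (-x)).2 h0
    simpa using this
  rw [lpPiece, lpPiece, lpPiece, mulOp, mulOp, mulOp, Real.fourierInv_eq, Real.fourierInv_eq,
    Real.fourierInv_eq, ← integral_add (hi u) (hi v)]
  congr 1
  ext η
  rw [hF, mul_add, smul_add]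

/-- Smooth truncation of a Schwartz function at height `b`. -/
lemma exists_schwartz_truncation (f : 𝓢(V n, ℂ)) {b : ℝ} (hb : 0 < b) :
    ∃ u v : 𝓢(V n, ℂ), f = u + v ∧ (∀ x, ‖u x‖ ≤ ‖f x‖) ∧ (∀ x, ‖f x‖ ≤ b → u x = 0) ∧
      ∀ x, ‖v x‖ ≤ 2 * b := by
  let w : V n → ℂ := fun x => ((1 - cut (‖f x‖ ^ 2 / (4 * b ^ 2)) : ℝ) : ℂ) * f x
  have hw : ContDiff ℝ ∞ w := by
    refine ContDiff.mul ?_ (f.smooth _)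
    refine Complex.ofRealCLM.contDiff.comp (contDiff_const.sub (contDiff_cut.comp ?_))
    exact ((f.smooth _).norm_sq ℝ).div_const _
  have hw0 : ∀ x, ‖f x‖ ≤ b → w x = 0 := by
    intro x hx
    have : ‖f x‖ ^ 2 / (4 * b ^ 2) ≤ 1 / 4 := by
      rw [div_le_iff₀ (by positivity)]
      have : ‖f x‖ ^ 2 ≤ b ^ 2 := by gcongr
      linarith
    simp only [w, cut_eq_one this]
    simp
  have hc : HasCompactSupport w := by
    have h0 := f.tendsto_cocompact
    have h1 : ∀ᶠ x in cocompact (V n), ‖f x‖ < b :=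
      (tendsto_zero_iff_norm_tendsto_zero.1 h0).eventually_lt_const hb
    obtain ⟨K, hK, hK2⟩ := mem_cocompact.1 h1
    exact HasCompactSupport.intro hK fun x hx => hw0 x (le_of_lt (hK2 hx))
  refine ⟨hc.toSchwartzMap hw, f - hc.toSchwartzMap hw, by simp, fun x => ?_, hw0, fun x => ?_⟩
  · change ‖w x‖ ≤ _
    rw [norm_mul, Complex.norm_real]
    refine mul_le_of_le_one_left (norm_nonneg _) ?_
    rw [Real.norm_eq_abs, abs_le]
    have h1 := cut_nonneg (‖f x‖ ^ 2 / (4 * b ^ 2))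
    have h2 := cut_le_one (‖f x‖ ^ 2 / (4 * b ^ 2))
    constructor <;> linarith
  · change ‖f x - w x‖ ≤ _
    have e : f x - w x = ((cut (‖f x‖ ^ 2 / (4 * b ^ 2)) : ℝ) : ℂ) * f x := by
      simp only [w]
      push_cast
      ring
    rw [e, norm_mul, Complex.norm_real, Real.norm_of_nonneg (cut_nonneg _)]
    by_cases hx : ‖f x‖ ≤ 2 * b
    · exact (mul_le_of_le_one_left (norm_nonneg _) (cut_le_one _)).trans hx
    · rw [cut_eq_zero, zero_mul]
      · positivity
      · rw [le_div_iff₀ (by positivity)]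
        nlinarith

lemma maxFn_le_of_le {f : V n → ℝ≥0∞} {M : ℝ≥0∞} (h : ∀ x, f x ≤ M) (x : V n) :
    maxFn f x ≤ M := by
  have := maxFn_le_add_const f (fun _ => 0) measurable_const M (by simpa using h) x
  simpa [maxFn] using this

/-- The `ℓ^p(L^p)` Littlewood–Paley inequality for `p > 2`. -/
lemma exists_tsum_lintegral_lpPiece_le {p : ℝ} (hp : 2 < p) :
    ∃ C : ℝ≥0∞, C ≠ ⊤ ∧ ∀ f : 𝓢(V n, ℂ),
      ∑' k : ℤ, ∫⁻ x, ‖lpPiece k f x‖ₑ ^ p ≤ C * ∫⁻ x, ‖f x‖ₑ ^ p := by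
  obtain ⟨C₀, hC₀, hbd⟩ := exists_enorm_mulOp_radial_le_single (n := n)
    (b := fun r => (ann r : ℂ)) (Complex.ofRealCLM.contDiff.comp contDiff_ann)
    (r₀ := 1 / 128) (by norm_num)
    (fun r hr => by simp only [ann_eq_zero_of_lt hr.le, ann_eq_zero_of_lt (r := 0) (by norm_num)])
    (R := 4) (fun r hr => by simp only [ann_eq_zero_of_gt hr.le, Complex.ofReal_zero])
  set c : ℝ := (4 * (C₀.toReal + 1))⁻¹ with hc
  have hC0 : 0 ≤ C₀.toReal := ENNReal.toReal_nonneg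
  have hc0 : 0 < c := by positivity
  refine ⟨ENNReal.ofReal (p * (p - 2)⁻¹ * c⁻¹ ^ (p - 2)) * 44,
    ENNReal.mul_ne_top ENNReal.ofReal_ne_top (by norm_num), fun f => ?_⟩
  have hFm : Measurable (fun q : ℤ × V n => ‖lpPiece q.1 f q.2‖ₑ) :=
    measurable_from_prod_countable_right fun k => (continuous_lpPiece k f).measurable.enorm
  have key := lintegral_rpow_le_of_weak (μ := (volume : Measure (V n)))
    (ν := (Measure.count : Measure ℤ).prod (volume : Measure (V n))) (q := 2) (p := p)
    (by norm_num) hp (c := c) hc0 44 (f := fun x => ‖f x‖ₑ) f.continuous.measurable.enorm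
    (F := fun q : ℤ × V n => ‖lpPiece q.1 f q.2‖ₑ) ?_
  · rw [lintegral_prod _ (hFm.pow_const p).aemeasurable, lintegral_count] at key
    exact key
  intro l hl
  obtain ⟨u, v, huv, hu1, hu2, hv⟩ := exists_schwartz_truncation f (b := c * l) (by positivity)
  have hvb : ∀ k x, ‖lpPiece k v x‖ₑ ≤ ENNReal.ofReal (l / 2) := by
    intro k x
    refine (hbd (2 ^ k) (by positivity) v x).trans ?_
    have h1 : maxFn (fun y => ‖v y‖ₑ) x ≤ ENNReal.ofReal (2 * (c * l)) :=
      maxFn_le_of_le (fun y => by rw [← ofReal_norm]; exact ENNReal.ofReal_le_ofReal (hv y)) x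
    calc C₀ * maxFn (fun y => ‖v y‖ₑ) x
        ≤ ENNReal.ofReal C₀.toReal * ENNReal.ofReal (2 * (c * l)) := by
          rw [ENNReal.ofReal_toReal hC₀]; gcongr
      _ = ENNReal.ofReal (C₀.toReal * (2 * (c * l))) := by rw [ENNReal.ofReal_mul hC0]
      _ ≤ _ := by
        apply ENNReal.ofReal_le_ofReal
        have : C₀.toReal * c ≤ 1 / 4 := by
          rw [hc, ← div_eq_mul_inv, div_le_iff₀ (by positivity)]
          linarith
        nlinarith
  have hsub : ∀ k : ℤ, volume {x | ENNReal.ofReal l < ‖lpPiece k f x‖ₑ} ≤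
      ENNReal.ofReal (4 * l ^ (-2 : ℝ)) * ∫⁻ x, ‖lpPiece k u x‖ₑ ^ 2 := by
    intro k
    have hs : {x | ENNReal.ofReal l < ‖lpPiece k f x‖ₑ} ⊆
        {x | ENNReal.ofReal ((l / 2) ^ 2) ≤ ‖lpPiece k u x‖ₑ ^ 2} := by
      intro x hx
      rw [mem_ofPred_eq] at hx ⊢
      have h1 : ENNReal.ofReal (l / 2) ≤ ‖lpPiece k u x‖ₑ := by
        by_contra! hcon
        apply absurd hx
        rw [not_lt, huv, lpPiece_add]
        refine (enorm_add_le _ _).trans ((add_le_add hcon.le (hvb k x)).trans ?_)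
        rw [← ENNReal.ofReal_add (by positivity) (by positivity), add_halves]
      rw [ENNReal.ofReal_pow (by positivity)]
      gcongr
    refine (measure_mono hs).trans ?_
    have hcm := mul_meas_ge_le_lintegral (μ := (volume : Measure (V n)))
      ((continuous_lpPiece k u).measurable.enorm.pow_const 2) (ENNReal.ofReal ((l / 2) ^ 2))
    have e : ENNReal.ofReal (4 * l ^ (-2 : ℝ)) * ENNReal.ofReal ((l / 2) ^ 2) = 1 := by
      rw [← ENNReal.ofReal_mul (by positivity), Real.rpow_neg hl.le]
      norm_num
      field_simp
      norm_num
    calc _ = ENNReal.ofReal (4 * l ^ (-2 : ℝ)) * (ENNReal.ofReal ((l / 2) ^ 2) *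
          volume {x | ENNReal.ofReal ((l / 2) ^ 2) ≤ ‖lpPiece k u x‖ₑ ^ 2}) := by
          rw [← mul_assoc, e, one_mul]
      _ ≤ _ := by gcongr
  have hmeas : MeasurableSet {q : ℤ × V n | ENNReal.ofReal l < ‖lpPiece q.1 f q.2‖ₑ} :=
    measurableSet_lt measurable_const hFm
  rw [Measure.prod_apply hmeas, lintegral_count]
  have hu : ∫⁻ x, ‖u x‖ₑ ^ 2 ≤
      ∫⁻ x in {x | ENNReal.ofReal (c * l) < ‖f x‖ₑ}, ‖f x‖ₑ ^ (2 : ℝ) := by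
    have hm : MeasurableSet {x | ENNReal.ofReal (c * l) < ‖f x‖ₑ} :=
      measurableSet_lt measurable_const f.continuous.measurable.enorm
    rw [← lintegral_indicator hm]
    refine lintegral_mono fun x => ?_
    by_cases hx : x ∈ {x | ENNReal.ofReal (c * l) < ‖f x‖ₑ}
    · rw [indicator_of_mem hx]
      rw [ENNReal.rpow_ofNat]
      gcongr
      rw [← ofReal_norm, ← ofReal_norm]
      exact ENNReal.ofReal_le_ofReal (hu1 x)
    · rw [indicator_of_notMem hx, hu2 x]
      · simp
      · rw [mem_ofPred_eq, not_lt, ← ofReal_norm] at hx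
        exact (ENNReal.ofReal_le_ofReal_iff (by positivity)).1 hx
  calc ∑' k : ℤ, volume (Prod.mk k ⁻¹' {q : ℤ × V n | ENNReal.ofReal l < ‖lpPiece q.1 f q.2‖ₑ})
      ≤ ∑' k : ℤ, ENNReal.ofReal (4 * l ^ (-2 : ℝ)) * ∫⁻ x, ‖lpPiece k u x‖ₑ ^ 2 :=
        ENNReal.tsum_le_tsum hsub
    _ = ENNReal.ofReal (4 * l ^ (-2 : ℝ)) * ∑' k : ℤ, ∫⁻ x, ‖lpPiece k u x‖ₑ ^ 2 :=
        ENNReal.tsum_mul_left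
    _ ≤ ENNReal.ofReal (4 * l ^ (-2 : ℝ)) * (11 * ∫⁻ x, ‖u x‖ₑ ^ 2) := by
        gcongr; exact tsum_lintegral_lpPiece_sq_le u
    _ = 44 * ENNReal.ofReal (l ^ (-2 : ℝ)) * ∫⁻ x, ‖u x‖ₑ ^ 2 := by
        rw [ENNReal.ofReal_mul (by norm_num), ENNReal.ofReal_ofNat]
        rw [show (44 : ℝ≥0∞) = 4 * 11 by norm_num]
        ring
    _ ≤ _ := by gcongr

lemma lintegral_comp_smul_of_pos {E : Type*} [NormedAddCommGroup E] [NormedSpace ℝ E]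
    [MeasurableSpace E] [BorelSpace E] [FiniteDimensional ℝ E] (μ : Measure E) [μ.IsAddHaarMeasure]
    (f : E → ℝ≥0∞) {s : ℝ} (hs : 0 < s) :
    ∫⁻ x, f (s • x) ∂μ = ENNReal.ofReal (s⁻¹ ^ Module.finrank ℝ E) * ∫⁻ x, f x ∂μ := by
  rw [← (measurableEmbedding_const_smul₀ hs.ne').lintegral_map, Measure.map_addHaar_smul μ hs.ne',
    lintegral_smul_measure, abs_of_pos (by positivity), inv_pow, smul_eq_mul]

lemma exists_schwartz_dilate (f : 𝓢(V n, ℂ)) {s : ℝ} (hs : 0 < s) :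
    ∃ g : 𝓢(V n, ℂ), ∀ x, g x = f (s • x) :=
  ⟨SchwartzMap.compCLMOfContinuousLinearEquiv ℂ
    (ContinuousLinearEquiv.smulLeft (Units.mk0 s hs.ne')) f, fun _ => rfl⟩

lemma exists_schwartz_conj (f : 𝓢(V n, ℂ)) :
    ∃ g : 𝓢(V n, ℂ), ∀ x, g x = starRingEnd ℂ (f x) :=
  ⟨f.postcompCLM (𝕜 := ℝ) (Complex.conjCLE : ℂ →L[ℝ] ℂ), fun _ => rfl⟩

lemma fourier_conj {f g : V n → ℂ} (h : ∀ x, g x = starRingEnd ℂ (f x)) (η : V n) :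
    𝓕 g η = starRingEnd ℂ (𝓕 f (-η)) := by
  rw [Real.fourier_eq, Real.fourier_eq, ← integral_conj]
  congr 1
  ext y
  rw [h, Circle.smul_def, Circle.smul_def, smul_eq_mul, smul_eq_mul, map_mul,
    ← Circle.coe_inv_eq_conj, ← AddChar.map_neg_eq_inv]
  simp

/-- The function `g` has frequencies in the annulus `1/128 ≤ |η| ≤ 4`. -/
def AnnSupp (g : 𝓢(V n, ℂ)) : Prop :=
  ∀ η, 𝓕 (g : V n → ℂ) η ≠ 0 → 1 / 128 ≤ ‖η‖ ∧ ‖η‖ ≤ 4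

lemma mulOp_congr {m m' : V n → ℂ} {f : 𝓢(V n, ℂ)}
    (h : ∀ η, 𝓕 (f : V n → ℂ) η ≠ 0 → m η = m' η) : mulOp m f = mulOp m' f := by
  have : (fun η => m η * 𝓕 (f : V n → ℂ) η) = fun η => m' η * 𝓕 (f : V n → ℂ) η := by
    ext η
    by_cases hη : 𝓕 (f : V n → ℂ) η = 0
    · rw [hη, mul_zero, mul_zero]
    · rw [h η hη]
  ext x
  rw [mulOp, mulOp, this]

lemma wave_smul (t : ℝ) {s : ℝ} (hs : 0 < s) (η : V n) : wave t (s • η) = wave (t * s) η := by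
  rw [wave, wave, norm_smul, Real.norm_of_nonneg hs.le]
  ring_nf

lemma mulOp_wave_neg {f g : 𝓢(V n, ℂ)} (h : ∀ x, g x = starRingEnd ℂ (f x)) (t : ℝ) (x : V n) :
    mulOp (wave (-t)) f x = starRingEnd ℂ (mulOp (wave t) g x) := by
  rw [mulOp, mulOp, Real.fourierInv_eq, Real.fourierInv_eq, ← integral_conj,
    ← integral_neg_eq_self]
  congr 1
  ext η
  rw [fourier_conj h]
  rw [Circle.smul_def, Circle.smul_def, smul_eq_mul, smul_eq_mul, map_mul, map_mul,
    ← Circle.coe_inv_eq_conj, ← AddChar.map_neg_eq_inv, inner_neg_left, Complex.conj_conj]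
  congr 2
  rw [wave, wave, norm_neg, ← Complex.exp_conj, map_mul, Complex.conj_I, Complex.conj_ofReal]
  congr 1
  push_cast
  ring

lemma continuous_mulOp_wave (g : 𝓢(V n, ℂ)) :
    Continuous (fun q : ℝ × V n => mulOp (wave q.1) g q.2) := by
  simp_rw [mulOp, Real.fourierInv_eq]
  have hF := continuous_fourier g
  refine continuous_of_dominated (bound := fun η => ‖𝓕 (g : V n → ℂ) η‖) ?_ ?_
    (integrable_fourier g).norm ?_
  · intro q
    refine Continuous.aestronglyMeasurable ?_
    have : Continuous (fun η : V n => wave q.1 η) :=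
      continuous_wave_uncurry.comp (Continuous.prodMk_right q.1)
    have h2 : Continuous (fun η : V n => Real.fourierChar (⟪η, q.2⟫ : ℝ)) :=
      Real.continuous_fourierChar.comp (by fun_prop)
    exact h2.smul (this.mul hF)
  · intro q
    refine Eventually.of_forall fun η => ?_
    rw [Circle.norm_smul, norm_mul, norm_wave, one_mul]
  · refine Eventually.of_forall fun η => ?_
    have : Continuous (fun q : ℝ × V n => wave q.1 η) :=
      continuous_wave_uncurry.comp (continuous_fst.prodMk continuous_const)
    have h2 : Continuous (fun q : ℝ × V n => Real.fourierChar (⟪η, q.2⟫ : ℝ)) :=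
      Real.continuous_fourierChar.comp (by fun_prop)
    exact h2.smul (this.mul continuous_const)

/-- A wider annular cutoff, equal to `1` on `[1/128, 4]` and supported in `[1/256, 8]`. -/
def wide (r : ℝ) : ℝ := cut (r / 16) - cut (64 * r)

lemma wide_eq_one {r : ℝ} (h1 : 1 / 128 ≤ r) (h2 : r ≤ 4) : wide r = 1 := by
  rw [wide, cut_eq_one (by linarith), cut_eq_zero (by linarith), sub_zero]

lemma wide_eq_zero_of_lt {r : ℝ} (h : r ≤ 1 / 256) : wide r = 0 := by
  rw [wide, cut_eq_one (by linarith), cut_eq_one (by linarith), sub_self]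

lemma wide_eq_zero_of_gt {r : ℝ} (h : 8 ≤ r) : wide r = 0 := by
  rw [wide, cut_eq_zero (by linarith), cut_eq_zero (by linarith), sub_self]

lemma contDiff_wide : ContDiff ℝ ∞ wide :=
  (contDiff_cut.comp (contDiff_id.div_const 16)).sub
    (contDiff_cut.comp (contDiff_const.mul contDiff_id))

/-- A symbol that is smooth away from the origin becomes smooth after localisation to an
annulus. -/
lemma contDiff_wide_mul {φ : ℝ × ℝ → ℂ} (h : ∀ q : ℝ × ℝ, 0 < q.2 → ContDiffAt ℝ ∞ φ q) :
    ContDiff ℝ ∞ (fun q : ℝ × ℝ => (bump q.1 * wide q.2 : ℝ) * φ q) := by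
  rw [contDiff_iff_contDiffAt]
  intro q
  by_cases hq : 0 < q.2
  · have h1 : ContDiff ℝ ∞ (fun q : ℝ × ℝ => bump q.1 * wide q.2) :=
      (contDiff_bump.comp contDiff_fst).mul (contDiff_wide.comp contDiff_snd)
    have h2 : ContDiff ℝ ∞ (fun q : ℝ × ℝ => ((bump q.1 * wide q.2 : ℝ) : ℂ)) :=
      Complex.ofRealCLM.contDiff.comp h1
    exact h2.contDiffAt.mul (h q hq)
  · have h1 : ContDiffAt ℝ ∞ (fun _ : ℝ × ℝ => (0 : ℂ)) q := contDiffAt_const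
    refine h1.congr_of_eventuallyEq ?_
    have : ∀ᶠ q' : ℝ × ℝ in 𝓝 q, q'.2 < 1 / 256 :=
      (continuous_snd.tendsto q).eventually_lt_const (by linarith)
    filter_upwards [this] with q' hq'
    rw [wide_eq_zero_of_lt hq'.le]
    simp

lemma exists_enorm_mulOp_wide_le {φ : ℝ × ℝ → ℂ}
    (h : ∀ q : ℝ × ℝ, 0 < q.2 → ContDiffAt ℝ ∞ φ q) :
    ∃ C : ℝ≥0∞, C ≠ ⊤ ∧ ∀ (e : ℝ), |e| ≤ 1 → ∀ (f : 𝓢(V n, ℂ)) (x : V n),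
      ‖mulOp (fun η => (wide ‖η‖ : ℂ) * φ (e, ‖η‖)) f x‖ₑ ≤ C * maxFn (fun y => ‖f y‖ₑ) x := by
  obtain ⟨C, hC, hb⟩ := exists_enorm_mulOp_radial_le (n := n) (contDiff_wide_mul h)
    (r₀ := 1 / 256) (by norm_num)
    (fun e r hr => by
      have h0 : wide 0 = 0 := wide_eq_zero_of_lt (by norm_num)
      simp only [wide_eq_zero_of_lt hr.le, h0, mul_zero, Complex.ofReal_zero, zero_mul])
    (R := 8) (by
      rintro e r (h | h)
      · simp [bump_eq_zero (lt_trans (by norm_num) h)]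
      · simp [wide_eq_zero_of_gt h.le])
  refine ⟨C, hC, fun e he f x => ?_⟩
  have := hb e 1 one_pos f x
  simpa [bump_eq_one he] using this

lemma exists_enorm_mulOp_wave_le :
    ∃ C : ℝ≥0∞, C ≠ ⊤ ∧ ∀ τ : ℝ, |τ| ≤ 1 → ∀ (g : 𝓢(V n, ℂ)), AnnSupp g → ∀ x : V n,
      ‖mulOp (wave τ) g x‖ₑ ≤ C * maxFn (fun y => ‖g y‖ₑ) x := by
  have hsm : ContDiff ℝ ∞
      (fun q : ℝ × ℝ => Complex.exp (((2 * Real.pi * q.1 * q.2 : ℝ) : ℂ) * Complex.I)) := by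
    have h1 : ContDiff ℝ ∞ (fun q : ℝ × ℝ => 2 * Real.pi * q.1 * q.2) := by fun_prop
    have h2 : ContDiff ℝ ∞ (fun q : ℝ × ℝ => ((2 * Real.pi * q.1 * q.2 : ℝ) : ℂ)) :=
      Complex.ofRealCLM.contDiff.comp h1
    exact (h2.mul contDiff_const).cexp
  obtain ⟨C, hC, hb⟩ := exists_enorm_mulOp_wide_le (n := n) fun q _ => hsm.contDiffAt
  refine ⟨C, hC, fun τ hτ g hg x => ?_⟩
  refine le_of_eq_of_le ?_ (hb τ hτ g x)
  refine congrArg (fun F : V n → ℂ => ‖F x‖ₑ) (mulOp_congr fun η hη => ?_)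
  obtain ⟨h1, h2⟩ := hg η hη
  simp only [wide_eq_one h1 h2, wave, Complex.ofReal_one, one_mul]

lemma AnnSupp.conj {f g : 𝓢(V n, ℂ)} (h : ∀ x, g x = starRingEnd ℂ (f x)) (hf : AnnSupp f) :
    AnnSupp g := by
  intro η hη
  rw [fourier_conj h] at hη
  have := hf (-η) (fun h0 => hη (by rw [h0, map_zero]))
  rwa [norm_neg] at this

lemma contDiff_wide_radial {φ : ℝ → ℂ} (h : ContDiff ℝ ∞ φ) (s : ℝ) :
    ContDiff ℝ ∞ (fun η : V n => (wide ‖s • η‖ : ℂ) * φ ‖s • η‖) := by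
  have h1 := contDiff_radial (n := n)
    (contDiff_wide_mul (φ := fun q => φ q.2) fun q _ => (h.comp contDiff_snd).contDiffAt)
    (r₀ := 1 / 256) (by norm_num)
    (fun e r hr => by
      have h0 : wide 0 = 0 := wide_eq_zero_of_lt (by norm_num)
      simp only [wide_eq_zero_of_lt hr.le, h0, mul_zero, Complex.ofReal_zero, zero_mul])
  have h2 : ContDiff ℝ ∞ (fun η : V n => ((0 : ℝ), s • η)) :=
    contDiff_const.prodMk (contDiff_const_smul s)
  have h3 := h1.comp h2
  simpa only [Function.comp_def, bump_eq_one (e := 0) (by simp), one_mul] using h3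

lemma hasCompactSupport_wide_radial (φ : ℝ → ℂ) {s : ℝ} (hs : 0 < s) :
    HasCompactSupport (fun η : V n => (wide ‖s • η‖ : ℂ) * φ ‖s • η‖) := by
  refine HasCompactSupport.intro (isCompact_closedBall (0 : V n) (8 / s)) fun ξ hξ => ?_
  rw [mem_closedBall_zero_iff, not_le, div_lt_iff₀' hs] at hξ
  rw [norm_smul, Real.norm_of_nonneg hs.le, wide_eq_zero_of_gt hξ.le, Complex.ofReal_zero, zero_mul]

lemma mulOp_const_mul (c : ℂ) (m : V n → ℂ) (f : 𝓢(V n, ℂ)) (x : V n) :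
    mulOp (fun η => c * m η) f x = c * mulOp m f x := by
  rw [mulOp, mulOp, Real.fourierInv_eq, Real.fourierInv_eq, ← smul_eq_mul, ← integral_smul]
  congr 1
  ext η
  simp only [Circle.smul_def, smul_eq_mul]
  ring

/-- The symbol of the Bessel potential of order `a`, in Mathlib's normalisation. -/
def bessel (a : ℝ) (r : ℝ) : ℂ := (((1 + (2 * Real.pi * r) ^ 2) ^ (a / 2) : ℝ) : ℂ)

lemma contDiff_bessel (a : ℝ) : ContDiff ℝ ∞ (bessel a) := by
  have h1 : ContDiff ℝ ∞ (fun r : ℝ => (1 + (2 * Real.pi * r) ^ 2)) := by fun_prop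
  have h2 : ContDiff ℝ ∞ (fun r : ℝ => (1 + (2 * Real.pi * r) ^ 2) ^ (a / 2)) :=
    h1.rpow_const_of_ne fun r => by positivity
  exact Complex.ofRealCLM.contDiff.comp h2

lemma bessel_neg_mul (a r : ℝ) : bessel (-a) r * bessel a r = 1 := by
  rw [bessel, bessel, ← Complex.ofReal_mul, ← Real.rpow_add (by positivity)]
  simp [neg_div]

/-- Rescaling: the local smoothing operator acting on a rescaled function. -/
lemma exists_besselD_halfWave_eq (a : ℝ) {s : ℝ} (hs : 0 < s) {g : 𝓢(V n, ℂ)} (hg : AnnSupp g) :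
    ∃ F : 𝓢(V n, ℂ),
      (∀ x, F x = mulOp (fun η => (wide ‖η‖ : ℂ) * bessel a ‖s • η‖) g (s • x)) ∧
      ∀ t x, besselD (-a) (halfWave t F) x = mulOp (wave (t * s)) g (s • x) := by
  obtain ⟨gs, hgs⟩ := exists_schwartz_dilate g hs
  have hs' : 0 < s⁻¹ := by positivity
  have hφ : ContDiff ℝ ∞ (fun r => bessel a (s * r)) :=
    (contDiff_bessel a).comp (contDiff_const.mul contDiff_id)
  have hcancel : ∀ η : V n, bessel a (s * ‖s⁻¹ • η‖) = bessel a ‖η‖ := fun η => by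
    rw [norm_smul, Real.norm_of_nonneg hs'.le, mul_inv_cancel_left₀ hs.ne']
  have hsm := contDiff_wide_radial (n := n) hφ s⁻¹
  have hcs := hasCompactSupport_wide_radial (n := n) (fun r => bessel a (s * r)) hs'
  simp only [hcancel] at hsm hcs
  obtain ⟨F, hF1, hF2⟩ := exists_schwartz_mulOp hsm hcs gs
  refine ⟨F, fun x => ?_, fun t x => ?_⟩
  · rw [hF1, mulOp_comp_smul _ g gs hs hgs]
    simp only [smul_smul, inv_mul_cancel₀ hs.ne', one_smul]
  · have hφ2 : ContDiff ℝ ∞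
        (fun r => Complex.exp ((2 * Real.pi * (t * s) * r : ℝ) * Complex.I) *
          bessel a (s * r)) := by
      refine ContDiff.mul ?_ hφ
      have h1 : ContDiff ℝ ∞ (fun r : ℝ => 2 * Real.pi * (t * s) * r) := by fun_prop
      have h2 : ContDiff ℝ ∞ (fun r : ℝ => ((2 * Real.pi * (t * s) * r : ℝ) : ℂ)) :=
        Complex.ofRealCLM.contDiff.comp h1
      exact (h2.mul contDiff_const).cexp
    have hw : ∀ η : V n,
        Complex.exp ((2 * Real.pi * (t * s) * ‖s⁻¹ • η‖ : ℝ) * Complex.I) = wave t η := fun η => by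
      rw [← wave, wave_smul _ hs', mul_inv_cancel_right₀ hs.ne']
    have hsm2 := contDiff_wide_radial (n := n) hφ2 s⁻¹
    have hcs2 := hasCompactSupport_wide_radial (n := n) (fun r =>
      Complex.exp ((2 * Real.pi * (t * s) * r : ℝ) * Complex.I) * bessel a (s * r)) hs'
    simp only [hcancel, hw] at hsm2 hcs2
    obtain ⟨G, hG1, hG2⟩ := exists_schwartz_mulOp hsm2 hcs2 gs
    have hGF : halfWave t F = G := by
      ext x
      rw [halfWave_eq_mulOp, hG1, mulOp, mulOp]
      simp_rw [hF2]
      refine congrArg (fun F : V n → ℂ => 𝓕⁻ F x) (funext fun η => ?_)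
      ring
    rw [hGF, besselD_eq]
    simp_rw [hG2]
    have e1 : ∀ η, (((1 + (2 * Real.pi * ‖η‖) ^ 2) ^ (-a / 2) : ℝ) : ℂ) *
        (((wide ‖s⁻¹ • η‖ : ℝ) : ℂ) * (wave t η * bessel a ‖η‖) * 𝓕 (gs : V n → ℂ) η) =
        ((wide ‖s⁻¹ • η‖ : ℝ) : ℂ) * wave t η * 𝓕 (gs : V n → ℂ) η := by
      intro η
      rw [← bessel]
      linear_combination (((wide ‖s⁻¹ • η‖ : ℝ) : ℂ) * wave t η * 𝓕 (gs : V n → ℂ) η) *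
        bessel_neg_mul a ‖η‖
    simp_rw [e1]
    change mulOp (fun η => ((wide ‖s⁻¹ • η‖ : ℝ) : ℂ) * wave t η) gs x = _
    rw [mulOp_comp_smul _ g gs hs hgs]
    refine congrFun (mulOp_congr fun η hη => ?_) _
    obtain ⟨h1, h2⟩ := hg η hη
    rw [smul_smul, inv_mul_cancel₀ hs.ne', one_smul, wide_eq_one h1 h2, wave_smul _ hs]
    simp

/-- The `p`-th power of the `L^p` norm of the wave at time `τ`. -/
def waveMass (p : ℝ) (g : 𝓢(V n, ℂ)) (τ : ℝ) : ℝ≥0∞ := ∫⁻ x, ‖mulOp (wave τ) g x‖ₑ ^ p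

lemma exists_lintegral_waveMass_le (hn : 0 < n) {p a : ℝ} (hp : 1 < p) {C₁ : ℝ≥0∞} (hC₁ : C₁ ≠ ⊤)
    (hLS : ∀ f : 𝓢(V n, ℂ), ∫⁻ t in Icc (1 : ℝ) 2,
      ∫⁻ x, ‖besselD (-a) (halfWave t f) x‖ₑ ^ p ≤ C₁ * ∫⁻ x, ‖f x‖ₑ ^ p) :
    ∃ C : ℝ≥0∞, C ≠ ⊤ ∧ ∀ s : ℝ, 1 ≤ s → ∀ g : 𝓢(V n, ℂ), AnnSupp g →
      ∫⁻ t in Icc (1 : ℝ) 2, waveMass p g (t * s) ≤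
        C * ENNReal.ofReal (s ^ (a * p)) * ∫⁻ x, ‖g x‖ₑ ^ p := by
  have hφ : ∀ q : ℝ × ℝ, 0 < q.2 → ContDiffAt ℝ ∞
      (fun q : ℝ × ℝ => (((q.1 ^ 2 + (2 * Real.pi * q.2) ^ 2) ^ (a / 2) : ℝ) : ℂ)) q := by
    intro q hq
    have h1 : ContDiffAt ℝ ∞ (fun q : ℝ × ℝ => q.1 ^ 2 + (2 * Real.pi * q.2) ^ 2) q := by
      fun_prop
    have h2 : ContDiffAt ℝ ∞
        (fun q : ℝ × ℝ => (q.1 ^ 2 + (2 * Real.pi * q.2) ^ 2) ^ (a / 2)) q :=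
      h1.rpow_const_of_ne (by positivity)
    exact Complex.ofRealCLM.contDiff.contDiffAt.comp q h2
  obtain ⟨C₂, hC₂, hb⟩ := exists_enorm_mulOp_wide_le (n := n) hφ
  obtain ⟨C₃, hC₃, hmax⟩ := lintegral_maxFn_rpow_le hn hp
  have hp0 : 0 ≤ p := by linarith
  refine ⟨C₁ * (C₂ ^ p * C₃), ENNReal.mul_ne_top hC₁ (ENNReal.mul_ne_top
    (ENNReal.rpow_ne_top_of_nonneg hp0 hC₂) hC₃), fun s hs g hg => ?_⟩
  have hs0 : 0 < s := by linarith
  obtain ⟨F, hF1, hF2⟩ := exists_besselD_halfWave_eq a hs0 hg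
  have h1 := hLS F
  simp_rw [hF2] at h1
  have hdil : ∀ h : V n → ℝ≥0∞, ∫⁻ x, h (s • x) = ENNReal.ofReal (s⁻¹ ^ n) * ∫⁻ x, h x := by
    intro h
    rw [lintegral_comp_smul_of_pos _ _ hs0, finrank_euclideanSpace, Fintype.card_fin]
  have hFle : ∀ x, ‖F x‖ₑ ≤
      ENNReal.ofReal (s ^ a) * (C₂ * maxFn (fun y => ‖g y‖ₑ) (s • x)) := by
    intro x
    rw [hF1]
    have e : (fun η : V n => (wide ‖η‖ : ℂ) * bessel a ‖s • η‖) = fun η : V n =>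
        ((s ^ a : ℝ) : ℂ) * ((wide ‖η‖ : ℂ) *
          ((((s⁻¹) ^ 2 + (2 * Real.pi * ‖η‖) ^ 2) ^ (a / 2) : ℝ) : ℂ)) := by
      ext η
      have : (1 + (2 * Real.pi * ‖s • η‖) ^ 2) ^ (a / 2) =
          s ^ a * ((s⁻¹) ^ 2 + (2 * Real.pi * ‖η‖) ^ 2) ^ (a / 2) := by
        rw [norm_smul, Real.norm_of_nonneg hs0.le]
        have e2 : s ^ a = (s ^ 2) ^ (a / 2) := by
          rw [← Real.rpow_natCast, ← Real.rpow_mul hs0.le]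
          congr 1
          push_cast
          ring
        rw [e2, ← Real.mul_rpow (by positivity) (by positivity)]
        congr 1
        field_simp
      rw [bessel, this]
      push_cast
      ring
    rw [e, mulOp_const_mul, enorm_mul]
    refine mul_le_mul' (le_of_eq ?_) (hb s⁻¹ ?_ g _)
    · rw [← ofReal_norm, Complex.norm_real, Real.norm_of_nonneg (by positivity)]
    · rw [abs_of_pos (by positivity)]
      exact inv_le_one_of_one_le₀ hs
  have hFp : ∫⁻ x, ‖F x‖ₑ ^ p ≤ ENNReal.ofReal (s⁻¹ ^ n) *
      (ENNReal.ofReal (s ^ (a * p)) * (C₂ ^ p * C₃) * ∫⁻ x, ‖g x‖ₑ ^ p) := by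
    calc ∫⁻ x, ‖F x‖ₑ ^ p
        ≤ ∫⁻ x, (ENNReal.ofReal (s ^ a) * (C₂ * maxFn (fun y => ‖g y‖ₑ) (s • x))) ^ p :=
          lintegral_mono fun x => ENNReal.rpow_le_rpow (hFle x) hp0
      _ = ∫⁻ x, (ENNReal.ofReal (s ^ (a * p)) * C₂ ^ p) * maxFn (fun y => ‖g y‖ₑ) (s • x) ^ p := by
          congr 1
          ext x
          rw [ENNReal.mul_rpow_of_nonneg _ _ hp0, ENNReal.mul_rpow_of_nonneg _ _ hp0,
            ENNReal.ofReal_rpow_of_pos (by positivity), ← Real.rpow_mul hs0.le, mul_assoc]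
      _ = (ENNReal.ofReal (s ^ (a * p)) * C₂ ^ p) *
            (ENNReal.ofReal (s⁻¹ ^ n) * ∫⁻ x, maxFn (fun y => ‖g y‖ₑ) x ^ p) := by
          rw [lintegral_const_mul' _ _ (ENNReal.mul_ne_top ENNReal.ofReal_ne_top
            (ENNReal.rpow_ne_top_of_nonneg hp0 hC₂)),
            hdil (fun x => maxFn (fun y => ‖g y‖ₑ) x ^ p)]
      _ ≤ (ENNReal.ofReal (s ^ (a * p)) * C₂ ^ p) *
            (ENNReal.ofReal (s⁻¹ ^ n) * (C₃ * ∫⁻ x, ‖g x‖ₑ ^ p)) := by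
          gcongr
          exact hmax _ g.continuous.measurable.enorm
      _ = _ := by ring
  have hL : ∫⁻ t in Icc (1 : ℝ) 2, ∫⁻ x, ‖mulOp (wave (t * s)) g (s • x)‖ₑ ^ p =
      ENNReal.ofReal (s⁻¹ ^ n) * ∫⁻ t in Icc (1 : ℝ) 2, waveMass p g (t * s) := by
    rw [← lintegral_const_mul' _ _ ENNReal.ofReal_ne_top]
    congr 1
    ext t
    exact hdil (fun x => ‖mulOp (wave (t * s)) g x‖ₑ ^ p)
  rw [hL] at h1
  have hne : ENNReal.ofReal (s⁻¹ ^ n) ≠ 0 := by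
    rw [Ne, ENNReal.ofReal_eq_zero, not_le]
    positivity
  rw [← ENNReal.mul_le_mul_iff_right hne ENNReal.ofReal_ne_top]
  refine h1.trans ((mul_le_mul_right hFp C₁).trans (le_of_eq ?_))
  ring

lemma setLIntegral_Icc_two_mul_eq (J : ℝ → ℝ≥0∞) {s : ℝ} (hs : 0 < s) :
    ∫⁻ τ in Icc s (2 * s), J τ = ENNReal.ofReal s * ∫⁻ t in Icc (1 : ℝ) 2, J (t * s) := by
  have h := lintegral_comp_smul_of_pos (volume : Measure ℝ) ((Icc s (2 * s)).indicator J) hs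
  have e : (fun t : ℝ => (Icc s (2 * s)).indicator J (s • t)) =
      (Icc (1 : ℝ) 2).indicator fun t => J (t * s) := by
    ext t
    have hiff : s • t ∈ Icc s (2 * s) ↔ t ∈ Icc (1 : ℝ) 2 := by
      rw [smul_eq_mul, mem_Icc, mem_Icc]
      refine and_congr ⟨fun h => ?_, fun h => ?_⟩ ⟨fun h => ?_, fun h => ?_⟩ <;> nlinarith
    by_cases ht : t ∈ Icc (1 : ℝ) 2
    · rw [indicator_of_mem ht, indicator_of_mem (hiff.2 ht), smul_eq_mul, mul_comm]
    · rw [indicator_of_notMem ht, indicator_of_notMem (fun h' => ht (hiff.1 h'))]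
  rw [e, lintegral_indicator measurableSet_Icc, lintegral_indicator measurableSet_Icc,
    Module.finrank_self, pow_one] at h
  rw [h, ← mul_assoc, ← ENNReal.ofReal_mul hs.le, mul_inv_cancel₀ hs.ne', ENNReal.ofReal_one,
    one_mul]

lemma exists_weighted_lintegral_Ici_le {β γ : ℝ} (hβ : 0 ≤ β) (hγ : γ < β) :
    ∃ K : ℝ≥0∞, K ≠ ⊤ ∧ ∀ (J : ℝ → ℝ≥0∞) (A : ℝ≥0∞),
      (∀ s : ℝ, 1 ≤ s → ∫⁻ t in Icc (1 : ℝ) 2, J (t * s) ≤ A * ENNReal.ofReal (s ^ γ)) →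
      ∫⁻ τ in Ici (1 : ℝ), ENNReal.ofReal ((1 + |τ|) ^ (-1 - β)) * J τ ≤ K * A := by
  set q : ℝ := 2 ^ (γ - β) with hq
  have hq0 : 0 < q := by positivity
  have hq1 : q < 1 := Real.rpow_lt_one_of_one_lt_of_neg (by norm_num) (by linarith)
  refine ⟨∑' j : ℕ, ENNReal.ofReal (q ^ j), ?_, fun J A hJ => ?_⟩
  · rw [← ENNReal.ofReal_tsum_of_nonneg (fun j => by positivity)
      (summable_geometric_of_lt_one hq0.le hq1)]
    exact ENNReal.ofReal_ne_top
  have hcover : Ici (1 : ℝ) ⊆ ⋃ j : ℕ, Icc ((2 : ℝ) ^ j) (2 * 2 ^ j) := by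
    intro τ hτ
    obtain ⟨j, h1, h2⟩ := exists_nat_pow_near hτ (one_lt_two (α := ℝ))
    exact mem_iUnion.2 ⟨j, h1, by rw [pow_succ] at h2; linarith⟩
  refine (lintegral_mono_set hcover).trans ((lintegral_iUnion_le _ _).trans ?_)
  rw [← ENNReal.tsum_mul_right]
  refine ENNReal.tsum_le_tsum fun j => ?_
  set s : ℝ := 2 ^ j with hs
  have hs1 : 1 ≤ s := one_le_pow₀ (by norm_num)
  have hs0 : 0 < s := by linarith
  calc ∫⁻ τ in Icc s (2 * s), ENNReal.ofReal ((1 + |τ|) ^ (-1 - β)) * J τ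
      ≤ ∫⁻ τ in Icc s (2 * s), ENNReal.ofReal (s ^ (-1 - β)) * J τ := by
        refine setLIntegral_mono' measurableSet_Icc fun τ hτ => ?_
        refine mul_le_mul' (ENNReal.ofReal_le_ofReal ?_) le_rfl
        refine Real.rpow_le_rpow_of_nonpos hs0 ?_ (by linarith)
        have := le_abs_self τ
        linarith [hτ.1]
    _ = ENNReal.ofReal (s ^ (-1 - β)) *
          (ENNReal.ofReal s * ∫⁻ t in Icc (1 : ℝ) 2, J (t * s)) := by
        rw [lintegral_const_mul' _ _ ENNReal.ofReal_ne_top, setLIntegral_Icc_two_mul_eq J hs0]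
    _ ≤ ENNReal.ofReal (s ^ (-1 - β)) * (ENNReal.ofReal s * (A * ENNReal.ofReal (s ^ γ))) := by
        gcongr
        exact hJ s hs1
    _ = ENNReal.ofReal (s ^ (-1 - β) * s * s ^ γ) * A := by
        rw [ENNReal.ofReal_mul (by positivity), ENNReal.ofReal_mul (by positivity)]
        ring
    _ = ENNReal.ofReal (q ^ j) * A := by
        congr 2
        rw [hq, ← Real.rpow_natCast, ← Real.rpow_mul (by norm_num), mul_comm (γ - β),
          Real.rpow_mul (by norm_num), Real.rpow_natCast, ← hs]
        nth_rewrite 2 [← Real.rpow_one s]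
        rw [← Real.rpow_add hs0, ← Real.rpow_add hs0]
        congr 1
        ring

lemma exists_weighted_waveMass_le (hn : 0 < n) {p a β : ℝ} (hp : 1 < p) (hβ : 0 ≤ β)
    (hβa : a * p < β) {C₁ : ℝ≥0∞} (hC₁ : C₁ ≠ ⊤)
    (hLS : ∀ f : 𝓢(V n, ℂ), ∫⁻ t in Icc (1 : ℝ) 2,
      ∫⁻ x, ‖besselD (-a) (halfWave t ⇑f) x‖ₑ ^ p ≤ C₁ * ∫⁻ x, ‖f x‖ₑ ^ p) :
    ∃ C : ℝ≥0∞, C ≠ ⊤ ∧ ∀ g : 𝓢(V n, ℂ), AnnSupp g →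
      ∫⁻ τ, ENNReal.ofReal ((1 + |τ|) ^ (-1 - β)) * waveMass p g τ ≤ C * ∫⁻ x, ‖g x‖ₑ ^ p := by
  obtain ⟨C₂, hC₂, h2⟩ := exists_lintegral_waveMass_le hn hp hC₁ hLS
  obtain ⟨C₃, hC₃, h3⟩ := exists_enorm_mulOp_wave_le (n := n)
  obtain ⟨C₄, hC₄, h4⟩ := lintegral_maxFn_rpow_le hn hp
  obtain ⟨K, hK, hKJ⟩ := exists_weighted_lintegral_Ici_le hβ hβa
  have hp0 : 0 ≤ p := by linarith
  have hlarge : ∀ g : 𝓢(V n, ℂ), AnnSupp g →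
      ∫⁻ τ in Ici (1 : ℝ), ENNReal.ofReal ((1 + |τ|) ^ (-1 - β)) * waveMass p g τ ≤
        K * (C₂ * ∫⁻ x, ‖g x‖ₑ ^ p) := by
    intro g hg
    refine hKJ _ _ fun s hs => (h2 s hs g hg).trans (le_of_eq ?_)
    ring
  refine ⟨2 * (C₃ ^ p * C₄) + 2 * (K * C₂), ?_, fun g hg => ?_⟩
  · exact ENNReal.add_ne_top.2 ⟨ENNReal.mul_ne_top (by norm_num) (ENNReal.mul_ne_top
      (ENNReal.rpow_ne_top_of_nonneg hp0 hC₃) hC₄),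
      ENNReal.mul_ne_top (by norm_num) (ENNReal.mul_ne_top hK hC₂)⟩
  obtain ⟨g', hg'⟩ := exists_schwartz_conj g
  have hg'a : AnnSupp g' := hg.conj hg'
  have hcover : (univ : Set ℝ) ⊆ (Icc (-1) 1 ∪ Ici 1) ∪ Iic (-1) := by
    intro τ _
    rcases le_total τ (-1) with h | h
    · exact Or.inr h
    rcases le_total τ 1 with h' | h'
    · exact Or.inl (Or.inl ⟨h, h'⟩)
    · exact Or.inl (Or.inr h')
  set w : ℝ → ℝ≥0∞ := fun τ => ENNReal.ofReal ((1 + |τ|) ^ (-1 - β)) with hw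
  have hsmall : ∫⁻ τ in Icc (-1 : ℝ) 1, w τ * waveMass p g τ ≤
      2 * (C₃ ^ p * C₄) * ∫⁻ x, ‖g x‖ₑ ^ p := by
    calc ∫⁻ τ in Icc (-1 : ℝ) 1, w τ * waveMass p g τ
        ≤ ∫⁻ τ in Icc (-1 : ℝ) 1, (C₃ ^ p * C₄) * ∫⁻ x, ‖g x‖ₑ ^ p := by
          refine setLIntegral_mono' measurableSet_Icc fun τ hτ => ?_
          have hw1 : w τ ≤ 1 := by
            rw [hw, ENNReal.ofReal_le_one]
            exact Real.rpow_le_one_of_one_le_of_nonpos (by linarith [abs_nonneg τ])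
              (by linarith)
          calc w τ * waveMass p g τ ≤ 1 * waveMass p g τ := by gcongr
            _ = ∫⁻ x, ‖mulOp (wave τ) g x‖ₑ ^ p := by rw [one_mul, waveMass]
            _ ≤ ∫⁻ x, C₃ ^ p * maxFn (fun y => ‖g y‖ₑ) x ^ p := by
              refine lintegral_mono fun x => ?_
              rw [← ENNReal.mul_rpow_of_nonneg _ _ hp0]
              exact ENNReal.rpow_le_rpow (h3 τ (abs_le.2 hτ) g hg x) hp0
            _ = C₃ ^ p * ∫⁻ x, maxFn (fun y => ‖g y‖ₑ) x ^ p :=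
              lintegral_const_mul' _ _ (ENNReal.rpow_ne_top_of_nonneg hp0 hC₃)
            _ ≤ C₃ ^ p * (C₄ * ∫⁻ x, ‖g x‖ₑ ^ p) := by
              gcongr
              exact h4 _ g.continuous.measurable.enorm
            _ = _ := by ring
      _ = _ := by
          rw [setLIntegral_const, Real.volume_Icc]
          norm_num
          ring
  have hneg : ∫⁻ τ in Iic (-1 : ℝ), w τ * waveMass p g τ ≤ K * (C₂ * ∫⁻ x, ‖g x‖ₑ ^ p) := by
    have hw' : ∀ τ, waveMass p g (-τ) = waveMass p g' τ := by
      intro τ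
      unfold waveMass
      refine lintegral_congr fun x => ?_
      rw [mulOp_wave_neg (fun x => hg' x), ← ofReal_norm, RCLike.norm_conj, ofReal_norm]
    have h := hlarge g' hg'a
    have e : ∫⁻ x, ‖g' x‖ₑ ^ p = ∫⁻ x, ‖g x‖ₑ ^ p := by
      refine lintegral_congr fun x => ?_
      rw [hg', ← ofReal_norm, RCLike.norm_conj, ofReal_norm]
    rw [e] at h
    refine le_trans (le_of_eq ?_) h
    rw [← lintegral_indicator measurableSet_Iic, ← lintegral_indicator measurableSet_Ici,
      ← lintegral_neg_eq_self (μ := (volume : Measure ℝ)) ((Iic (-1 : ℝ)).indicator _)]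
    refine lintegral_congr fun τ => ?_
    by_cases hτ : τ ∈ Ici (1 : ℝ)
    · rw [indicator_of_mem hτ, indicator_of_mem (by simpa using hτ), hw']
      simp only [hw, abs_neg]
    · rw [indicator_of_notMem hτ, indicator_of_notMem (by simpa using hτ)]
  calc ∫⁻ τ, w τ * waveMass p g τ = ∫⁻ τ in univ, w τ * waveMass p g τ := by
        rw [setLIntegral_univ]
    _ ≤ ∫⁻ τ in (Icc (-1) 1 ∪ Ici 1) ∪ Iic (-1), w τ * waveMass p g τ :=
        lintegral_mono_set hcover
    _ ≤ _ := lintegral_union_le _ _ _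
    _ ≤ (∫⁻ τ in Icc (-1 : ℝ) 1, w τ * waveMass p g τ) +
        (∫⁻ τ in Ici (1 : ℝ), w τ * waveMass p g τ) +
        ∫⁻ τ in Iic (-1 : ℝ), w τ * waveMass p g τ := by
        gcongr
        exact lintegral_union_le _ _ _
    _ ≤ 2 * (C₃ ^ p * C₄) * (∫⁻ x, ‖g x‖ₑ ^ p) + K * (C₂ * ∫⁻ x, ‖g x‖ₑ ^ p) +
        K * (C₂ * ∫⁻ x, ‖g x‖ₑ ^ p) := by
        gcongr
        exact hlarge g hg
    _ = _ := by ring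

lemma posRpow_eq {δ : ℝ} (hδ : 0 < δ) (r : ℝ) : posRpow r δ = max r 0 ^ δ := by
  rw [posRpow]
  split_ifs with h
  · rw [max_eq_left h.le]
  · rw [max_eq_right (not_lt.1 h), Real.zero_rpow hδ.ne']

lemma continuous_posRpow {δ : ℝ} (hδ : 0 < δ) : Continuous (fun r => posRpow r δ) := by
  simp_rw [posRpow_eq hδ]
  exact (continuous_id.max continuous_const).rpow_const fun _ => Or.inr hδ.le

lemma posRpow_mul {c : ℝ} (hc : 0 < c) (r δ : ℝ) : posRpow (c * r) δ = c ^ δ * posRpow r δ := by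
  rw [posRpow, posRpow]
  by_cases h : 0 < r
  · rw [if_pos h, if_pos (mul_pos hc h), Real.mul_rpow hc.le h.le]
  · rw [if_neg h, if_neg (fun h' => h (pos_of_mul_pos_right h' hc.le)), mul_zero]

/-- The part of the profile `u₊^δ` near its singularity at `0`. -/
def edge (δ u : ℝ) : ℝ := posRpow u δ * (1 - cut (1 - u))

lemma edge_eq_zero_of_le {δ u : ℝ} (h : u ≤ 0) : edge δ u = 0 := by
  rw [edge, posRpow, if_neg (not_lt.2 h), zero_mul]

lemma edge_eq_zero_of_ge {δ u : ℝ} (h : 3 / 4 ≤ u) : edge δ u = 0 := by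
  rw [edge, cut_eq_one (by linarith), sub_self, mul_zero]

lemma continuous_edge {δ : ℝ} (hδ : 0 < δ) : Continuous (edge δ) :=
  (continuous_posRpow hδ).mul
    (continuous_const.sub (continuous_cut.comp (continuous_const.sub continuous_id)))

/-- A smooth dyadic piece of the profile `u₊^δ`. -/
def edgePiece (δ u : ℝ) : ℝ := posRpow u δ * (cut (1 - 2 * u) - cut (1 - u))

lemma edgePiece_eq_zero_of_le {δ u : ℝ} (h : u ≤ 1 / 4) : edgePiece δ u = 0 := by
  rw [edgePiece, cut_eq_zero (by linarith), cut_eq_zero (by linarith), sub_self, mul_zero]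

lemma edgePiece_eq_zero_of_ge {δ u : ℝ} (h : 3 / 4 ≤ u) : edgePiece δ u = 0 := by
  rw [edgePiece, cut_eq_one (by linarith), cut_eq_one (by linarith), sub_self, mul_zero]

lemma contDiff_edgePiece (δ : ℝ) : ContDiff ℝ ∞ (edgePiece δ) := by
  rw [contDiff_iff_contDiffAt]
  intro u
  rcases lt_or_ge 0 u with hu | hu
  · have h1 : ContDiffAt ℝ ∞ (fun u : ℝ => u ^ δ) u := Real.contDiffAt_rpow_const_of_ne hu.ne'
    have h2 : ContDiff ℝ ∞ (fun u : ℝ => cut (1 - 2 * u) - cut (1 - u)) :=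
      (contDiff_cut.comp (contDiff_const.sub (contDiff_const.mul contDiff_id))).sub
        (contDiff_cut.comp (contDiff_const.sub contDiff_id))
    refine (h1.mul h2.contDiffAt).congr_of_eventuallyEq ?_
    filter_upwards [lt_mem_nhds hu] with v hv
    rw [edgePiece, posRpow, if_pos hv]
  · refine (contDiffAt_const (c := (0 : ℝ))).congr_of_eventuallyEq ?_
    filter_upwards [gt_mem_nhds (show u < 1 / 4 by linarith)] with v hv
    exact edgePiece_eq_zero_of_le hv.le

lemma hasSum_edgePiece (δ u : ℝ) :
    HasSum (fun j : ℕ => (2 ^ j : ℝ) ^ (-δ) * edgePiece δ (2 ^ j * u)) (edge δ u) := by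
  have hterm : ∀ j : ℕ, (2 ^ j : ℝ) ^ (-δ) * edgePiece δ (2 ^ j * u) =
      posRpow u δ * (cut (1 - 2 ^ (j + 1) * u) - cut (1 - 2 ^ j * u)) := by
    intro j
    have h2 : (0 : ℝ) < 2 ^ j := by positivity
    rw [edgePiece, posRpow_mul h2, ← mul_assoc, ← mul_assoc, ← Real.rpow_add h2, neg_add_cancel,
      Real.rpow_zero, one_mul, ← mul_assoc, ← pow_succ']
  simp_rw [hterm]
  rcases le_or_gt u 0 with hu | hu
  · rw [edge_eq_zero_of_le hu, posRpow, if_neg (not_lt.2 hu)]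
    simp
  obtain ⟨J, hJ⟩ := pow_unbounded_of_one_lt u⁻¹ (one_lt_two (α := ℝ))
  have hbig : ∀ j, J ≤ j → cut (1 - 2 ^ j * u) = 1 := by
    intro j hj
    apply cut_eq_one
    have h1 : (2 : ℝ) ^ J ≤ 2 ^ j := pow_le_pow_right₀ (by norm_num) hj
    have h2 : 1 < 2 ^ j * u := by
      rw [← inv_lt_iff_one_lt_mul₀ hu]
      exact hJ.trans_le h1
    linarith
  have h := hasSum_sum_of_ne_finset_zero (L := .unconditional ℕ) (s := Finset.range J)
    (f := fun j : ℕ => posRpow u δ * (cut (1 - 2 ^ (j + 1) * u) - cut (1 - 2 ^ j * u)))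
    (fun j hj => by
      have hj' : J ≤ j := by simpa using hj
      rw [hbig j hj', hbig (j + 1) (by omega), sub_self, mul_zero])
  rwa [← Finset.mul_sum, Finset.sum_range_sub (fun j : ℕ => cut (1 - 2 ^ j * u)), hbig J le_rfl,
    pow_zero, one_mul, ← edge] at h

lemma hasCompactSupport_of_Icc {f : ℝ → ℂ} {a b : ℝ} (h1 : ∀ u, u ≤ a → f u = 0)
    (h2 : ∀ u, b ≤ u → f u = 0) : HasCompactSupport f := by
  refine HasCompactSupport.intro (isCompact_Icc (a := a) (b := b)) fun u hu => ?_
  rcases lt_or_ge u a with h | h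
  · exact h1 u h.le
  · exact h2 u (not_le.1 fun h' => hu ⟨h, h'⟩).le

lemma continuous_fourier_of_integrable {f : ℝ → ℂ} (hf : Integrable f) : Continuous (𝓕 f) :=
  VectorFourier.fourierIntegral_continuous Real.continuous_fourierChar
    (by simpa using (by fun_prop : Continuous fun p : ℝ × ℝ => p.2 * p.1)) hf

lemma fourier_comp_mul_left (f : ℝ → ℂ) {c : ℝ} (hc : 0 < c) (s : ℝ) :
    𝓕 (fun u => f (c * u)) s = ((c⁻¹ : ℝ) : ℂ) * 𝓕 f (c⁻¹ * s) := by
  rw [Real.fourier_real_eq, Real.fourier_real_eq]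
  have h := Measure.integral_comp_mul_left
    (fun v : ℝ => Real.fourierChar (-(v * (c⁻¹ * s))) • f v) c
  rw [abs_of_pos (by positivity), Complex.real_smul] at h
  rw [← h]
  congr 1
  ext v
  congr 3
  field_simp

lemma exists_norm_fourier_schwartz_le (b : 𝓢(ℝ, ℂ)) (ρ : ℝ) :
    ∃ C : ℝ, 0 ≤ C ∧ ∀ s, ‖𝓕 (b : ℝ → ℂ) s‖ ≤ C * (1 + |s|) ^ (-ρ) := by
  obtain ⟨N, hN⟩ := exists_nat_ge ρ
  refine ⟨2 ^ N * ((Finset.Iic (N, 0)).sup fun m => SchwartzMap.seminorm ℝ m.1 m.2) (𝓕 b),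
    by positivity, fun s => ?_⟩
  have h := SchwartzMap.one_add_le_sup_seminorm_apply (𝕜 := ℝ) (m := (N, 0)) le_rfl le_rfl (𝓕 b) s
  rw [norm_iteratedFDeriv_zero, Real.norm_eq_abs, SchwartzMap.fourier_coe] at h
  have h1 : 1 ≤ 1 + |s| := by linarith [abs_nonneg s]
  rw [Real.rpow_neg (by positivity), ← div_eq_mul_inv, le_div_iff₀ (by positivity), mul_comm]
  refine le_trans ?_ h
  gcongr
  rw [← Real.rpow_natCast]
  exact Real.rpow_le_rpow_of_exponent_le h1 hN

lemma exists_norm_fourier_edge_le {δ δ' : ℝ} (h0 : 0 < δ') (hδ : δ' < δ) :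
    ∃ C : ℝ, 0 ≤ C ∧ ∀ s, ‖𝓕 (fun u => (edge δ u : ℂ)) s‖ ≤ C * (1 + |s|) ^ (-(1 + δ')) := by
  have hbc : HasCompactSupport (fun u => (edgePiece δ u : ℂ)) :=
    hasCompactSupport_of_Icc (a := 1 / 4) (b := 3 / 4)
      (fun u hu => by rw [edgePiece_eq_zero_of_le hu, Complex.ofReal_zero])
      (fun u hu => by rw [edgePiece_eq_zero_of_ge hu, Complex.ofReal_zero])
  set b : 𝓢(ℝ, ℂ) := hbc.toSchwartzMap (Complex.ofRealCLM.contDiff.comp (contDiff_edgePiece δ))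
  have hb : (b : ℝ → ℂ) = fun u => (edgePiece δ u : ℂ) := rfl
  obtain ⟨C, hC0, hC⟩ := exists_norm_fourier_schwartz_le b (1 + δ')
  set q : ℝ := 2 ^ (δ' - δ) with hq
  have hq0 : 0 < q := by positivity
  have hq1 : q < 1 := Real.rpow_lt_one_of_one_lt_of_neg (by norm_num) (by linarith)
  have hq1' : (2 : ℝ) ^ (-δ - 1) < 1 :=
    Real.rpow_lt_one_of_one_lt_of_neg (by norm_num) (by linarith)
  have h_int : ∀ j : ℕ, Integrable fun u : ℝ => b (2 ^ j * u) := fun j =>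
    (SchwartzMap.integrable b).comp_mul_left' (by positivity)
  have hpow : ∀ (j : ℕ) (e : ℝ), ((2 : ℝ) ^ j) ^ e = (2 ^ e) ^ j := by
    intro j e
    rw [← Real.rpow_natCast, ← Real.rpow_mul (by norm_num), mul_comm, Real.rpow_mul (by norm_num),
      Real.rpow_natCast]
  refine ⟨C * (1 - q)⁻¹, by
    have : 0 < 1 - q := by linarith
    positivity, fun s => ?_⟩
  have hF := hasSum_integral_of_summable_integral_norm (μ := (volume : Measure ℝ))
    (F := fun (j : ℕ) (v : ℝ) =>
      Real.fourierChar (-(v * s)) • ((((2 ^ j : ℝ) ^ (-δ) : ℝ) : ℂ) * b (2 ^ j * v))) ?_ ?_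
  rotate_left
  · intro j
    have h1 := (h_int j).const_mul (((2 ^ j : ℝ) ^ (-δ) : ℝ) : ℂ)
    have h2 := (Real.fourierIntegral_convergent_iff (μ := volume) s).2 h1
    simpa [mul_comm] using h2
  · have e : ∀ j : ℕ, (∫ v : ℝ, ‖Real.fourierChar (-(v * s)) •
        ((((2 ^ j : ℝ) ^ (-δ) : ℝ) : ℂ) * b (2 ^ j * v))‖) =
        ((2 : ℝ) ^ (-δ - 1)) ^ j * ∫ v, ‖b v‖ := by
      intro j
      simp_rw [Circle.norm_smul, norm_mul]
      rw [integral_const_mul, Measure.integral_comp_mul_left (fun v => ‖b v‖),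
        abs_of_pos (by positivity), smul_eq_mul, ← mul_assoc, ← hpow, Complex.norm_real,
        Real.norm_of_nonneg (by positivity), Real.rpow_sub (by positivity), Real.rpow_one,
        div_eq_mul_inv]
    simp_rw [e]
    exact (summable_geometric_of_lt_one (by positivity) hq1').mul_right _
  have hsum : (∫ v : ℝ, ∑' j : ℕ, Real.fourierChar (-(v * s)) •
      ((((2 ^ j : ℝ) ^ (-δ) : ℝ) : ℂ) * b (2 ^ j * v))) = 𝓕 (fun u => (edge δ u : ℂ)) s := by
    rw [Real.fourier_real_eq]
    congr 1
    ext v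
    have h1 := Complex.hasSum_ofReal.2 (hasSum_edgePiece δ v)
    have h2 := h1.mul_left (Real.fourierChar (-(v * s)) : ℂ)
    rw [Circle.smul_def, smul_eq_mul, ← h2.tsum_eq]
    refine tsum_congr fun j => ?_
    rw [Circle.smul_def, smul_eq_mul, hb, Complex.ofReal_mul]
  have hterm : ∀ j : ℕ, (∫ v : ℝ, Real.fourierChar (-(v * s)) •
      ((((2 ^ j : ℝ) ^ (-δ) : ℝ) : ℂ) * b (2 ^ j * v))) =
      (((2 ^ j : ℝ) ^ (-δ) : ℝ) : ℂ) * ((((2 ^ j)⁻¹ : ℝ) : ℂ) * 𝓕 (b : ℝ → ℂ) ((2 ^ j)⁻¹ * s)) := by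
    intro j
    rw [← fourier_comp_mul_left _ (by positivity), Real.fourier_real_eq, ← integral_const_mul]
    congr 1
    ext v
    rw [Circle.smul_def, Circle.smul_def, smul_eq_mul, smul_eq_mul]
    ring
  rw [hsum] at hF
  rw [← hF.tsum_eq]
  refine tsum_of_norm_bounded (g := fun j : ℕ => C * (1 + |s|) ^ (-(1 + δ')) * q ^ j) ?_ fun j => ?_
  · have := (hasSum_geometric_of_lt_one hq0.le hq1).mul_left (C * (1 + |s|) ^ (-(1 + δ')))
    rwa [mul_right_comm C _ (1 - q)⁻¹] at this
  · rw [hterm, norm_mul, norm_mul, Complex.norm_real, Complex.norm_real,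
      Real.norm_of_nonneg (by positivity), Real.norm_of_nonneg (by positivity)]
    set c : ℝ := 2 ^ j with hc
    have hc0 : 0 < c := by positivity
    have hc1 : 1 ≤ c := one_le_pow₀ (by norm_num)
    have h1 : (1 + |c⁻¹ * s|) ^ (-(1 + δ')) ≤ c ^ (1 + δ') * (1 + |s|) ^ (-(1 + δ')) := by
      have : (c⁻¹ * (1 + |s|)) ^ (-(1 + δ')) = c ^ (1 + δ') * (1 + |s|) ^ (-(1 + δ')) := by
        rw [Real.mul_rpow (by positivity) (by positivity), Real.inv_rpow hc0.le,
          Real.rpow_neg hc0.le, inv_inv]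
      rw [← this]
      refine Real.rpow_le_rpow_of_nonpos (by positivity) ?_ (by linarith)
      rw [abs_mul, abs_of_pos (inv_pos.2 hc0), mul_add, mul_one]
      linarith [inv_le_one_of_one_le₀ hc1]
    calc c ^ (-δ) * (c⁻¹ * ‖𝓕 (b : ℝ → ℂ) (c⁻¹ * s)‖)
        ≤ c ^ (-δ) * (c⁻¹ * (C * (c ^ (1 + δ') * (1 + |s|) ^ (-(1 + δ'))))) := by
          gcongr
          exact (hC _).trans (by gcongr)
      _ = C * (1 + |s|) ^ (-(1 + δ')) * (c ^ (-δ) * c⁻¹ * c ^ (1 + δ')) := by ring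
      _ = C * (1 + |s|) ^ (-(1 + δ')) * q ^ j := by
          rw [hq, ← hpow, ← hc, ← Real.rpow_neg_one c, ← Real.rpow_add hc0, ← Real.rpow_add hc0]
          ring_nf

lemma exists_edge_eq_integral {δ δ' : ℝ} (h0 : 0 < δ') (hδ : δ' < δ) :
    ∃ (H : ℝ → ℂ) (C : ℝ), Continuous H ∧ 0 ≤ C ∧
      (∀ s, ‖H s‖ ≤ C * (1 + |s|) ^ (-(1 + δ'))) ∧ Integrable H ∧
      ∀ r : ℝ, (edge δ (1 - r) : ℂ) =
        ∫ s, H s * Complex.exp (((2 * Real.pi * s * r : ℝ) : ℂ) * Complex.I) := by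
  set B : ℝ → ℂ := fun u => (edge δ u : ℂ) with hB
  obtain ⟨C, hC0, hC⟩ := exists_norm_fourier_edge_le h0 hδ
  have hBc : Continuous B := Complex.continuous_ofReal.comp (continuous_edge (h0.trans hδ))
  have hBi : Integrable B := hBc.integrable_of_hasCompactSupport
    (hasCompactSupport_of_Icc (a := 0) (b := 3 / 4)
      (fun u hu => by rw [hB]; simp only [edge_eq_zero_of_le hu, Complex.ofReal_zero])
      (fun u hu => by rw [hB]; simp only [edge_eq_zero_of_ge hu, Complex.ofReal_zero]))
  have hFc := continuous_fourier_of_integrable hBi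
  set H : ℝ → ℂ := fun s =>
    𝓕 B (-s) * Complex.exp (((-(2 * Real.pi * s) : ℝ) : ℂ) * Complex.I) with hH
  have hHn : ∀ s, ‖H s‖ = ‖𝓕 B (-s)‖ := fun s => by
    rw [hH]
    simp only [norm_mul, Complex.norm_exp_ofReal_mul_I, mul_one]
  have hHc : Continuous H := by
    have := hFc.comp continuous_neg
    rw [hH]
    exact this.mul (by fun_prop)
  have hHb : ∀ s, ‖H s‖ ≤ C * (1 + |s|) ^ (-(1 + δ')) := fun s => by
    rw [hHn]
    simpa using hC (-s)
  have hwi : Integrable (fun s : ℝ => C * (1 + |s|) ^ (-(1 + δ'))) :=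
    (integrable_one_add_norm (E := ℝ) (r := 1 + δ') (by simp [h0])).const_mul C
  have hFi : Integrable (𝓕 B) :=
    hwi.mono' hFc.aestronglyMeasurable (Eventually.of_forall hC)
  refine ⟨H, C, hHc, hC0, hHb,
    hwi.mono' hHc.aestronglyMeasurable (Eventually.of_forall hHb), fun r => ?_⟩
  have h1 := congrFun (hBc.fourierInv_fourier_eq hBi hFi) (1 - r)
  rw [Real.fourierInv_eq'] at h1
  rw [← integral_neg_eq_self]
  change B (1 - r) = _
  rw [← h1]
  congr 1
  ext s
  rw [hH]
  simp only [neg_neg, smul_eq_mul]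
  rw [mul_assoc (𝓕 B s), ← Complex.exp_add, mul_comm (𝓕 B s)]
  congr 2
  simp only [RCLike.inner_apply, conj_trivial]
  push_cast
  ring

lemma exists_lintegral_weight_rpow_le {p β δ : ℝ} (hp : 1 < p) (hβ : β < p * δ) :
    ∃ K : ℝ≥0∞, K ≠ ⊤ ∧ ∀ φ : ℝ → ℝ≥0∞, Measurable φ →
      (∫⁻ τ, ENNReal.ofReal ((1 + |τ|) ^ (-(1 + δ))) * φ τ) ^ p ≤
        K * ∫⁻ τ, ENNReal.ofReal ((1 + |τ|) ^ (-1 - β)) * φ τ ^ p := by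
  have hp0 : 0 < p := by linarith
  have hpq := Real.HolderConjugate.conjExponent hp
  have hq0 : 0 < p.conjExponent := hpq.symm.pos
  set q := p.conjExponent with hq
  set e : ℝ := (1 + δ) - (1 + β) / p with he
  have heq : 1 < e * q := by
    have hp1 : 0 < p - 1 := by linarith
    rw [hq, Real.conjExponent, ← mul_div_assoc, lt_div_iff₀ hp1, he, sub_mul,
      div_mul_cancel₀ _ hp0.ne']
    nlinarith
  have hpos : ∀ τ : ℝ, 0 < 1 + |τ| := fun τ => by linarith [abs_nonneg τ]
  have hAm : ∀ e : ℝ, Measurable fun τ : ℝ => ENNReal.ofReal ((1 + |τ|) ^ e) := by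
    intro e
    have : Continuous fun τ : ℝ => (1 + |τ|) ^ e :=
      (continuous_const.add continuous_abs).rpow_const fun τ => Or.inl (hpos τ).ne'
    exact this.measurable.ennreal_ofReal
  have hAq : ∫⁻ τ : ℝ, ENNReal.ofReal ((1 + |τ|) ^ (-e)) ^ q ≠ ⊤ := by
    have h1 := (integrable_one_add_norm (E := ℝ) (μ := volume) (r := e * q)
      (by simpa using heq)).lintegral_lt_top
    have e1 : ∀ τ : ℝ, ENNReal.ofReal ((1 + |τ|) ^ (-e)) ^ q =
        ENNReal.ofReal ((1 + ‖τ‖) ^ (-(e * q))) := by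
      intro τ
      rw [ENNReal.ofReal_rpow_of_pos (Real.rpow_pos_of_pos (hpos τ) _),
        ← Real.rpow_mul (hpos τ).le, Real.norm_eq_abs, neg_mul]
    simp_rw [e1]
    exact h1.ne
  refine ⟨((∫⁻ τ : ℝ, ENNReal.ofReal ((1 + |τ|) ^ (-e)) ^ q) ^ (1 / q)) ^ p, ?_, fun φ hφ => ?_⟩
  · exact ENNReal.rpow_ne_top_of_nonneg hp0.le
      (ENNReal.rpow_ne_top_of_nonneg (by positivity) hAq)
  have hH := ENNReal.lintegral_mul_le_Lp_mul_Lq (volume : Measure ℝ) hpq.symm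
    (hAm (-e)).aemeasurable ((hAm (-(1 + β) / p)).mul hφ).aemeasurable
  have hl : ∀ τ : ℝ, ((fun τ => ENNReal.ofReal ((1 + |τ|) ^ (-e))) *
      ((fun τ => ENNReal.ofReal ((1 + |τ|) ^ (-(1 + β) / p))) * φ)) τ =
      ENNReal.ofReal ((1 + |τ|) ^ (-(1 + δ))) * φ τ := by
    intro τ
    rw [Pi.mul_apply, Pi.mul_apply, ← mul_assoc,
      ← ENNReal.ofReal_mul (Real.rpow_pos_of_pos (hpos τ) _).le, ← Real.rpow_add (hpos τ)]
    congr 3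
    rw [he]
    ring
  have hr : ∀ τ : ℝ, ((fun τ => ENNReal.ofReal ((1 + |τ|) ^ (-(1 + β) / p))) * φ) τ ^ p =
      ENNReal.ofReal ((1 + |τ|) ^ (-1 - β)) * φ τ ^ p := by
    intro τ
    rw [Pi.mul_apply, ENNReal.mul_rpow_of_nonneg _ _ hp0.le,
      ENNReal.ofReal_rpow_of_pos (Real.rpow_pos_of_pos (hpos τ) _), ← Real.rpow_mul (hpos τ).le,
      div_mul_cancel₀ _ hp0.ne']
    congr 3
    ring
  simp_rw [hl, hr] at hH
  refine (ENNReal.rpow_le_rpow hH hp0.le).trans (le_of_eq ?_)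
  rw [ENNReal.mul_rpow_of_nonneg _ _ hp0.le]
  congr 1
  rw [← ENNReal.rpow_mul, one_div_mul_cancel hp0.ne', ENNReal.rpow_one]

lemma mulOp_eq_integral_wave {H : ℝ → ℂ} (hHc : Continuous H) (hHi : Integrable H) {m : V n → ℂ}
    {t : ℝ} (hm : ∀ η : V n, m η =
      ∫ s, H s * Complex.exp (((2 * Real.pi * s * (t * ‖η‖) : ℝ) : ℂ) * Complex.I))
    (g : 𝓢(V n, ℂ)) (x : V n) :
    mulOp m g x = ∫ s, H s * mulOp (wave (s * t)) g x := by
  have hF := continuous_fourier g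
  set Φ : V n → ℝ → ℂ := fun v s =>
    H s * (Complex.exp (((2 * Real.pi * ⟪v, x⟫ : ℝ) : ℂ) * Complex.I) *
      (wave (s * t) v * 𝓕 (g : V n → ℂ) v)) with hΦ
  have hΦc : Continuous (Function.uncurry Φ) := by
    have h1 : Continuous fun q : V n × ℝ => wave (q.2 * t) q.1 := by
      unfold wave
      fun_prop
    exact (hHc.comp continuous_snd).mul ((by fun_prop : Continuous fun q : V n × ℝ =>
      Complex.exp (((2 * Real.pi * ⟪q.1, x⟫ : ℝ) : ℂ) * Complex.I)).mul
        (h1.mul (hF.comp continuous_fst)))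
  have hΦi : Integrable (Function.uncurry Φ) (volume.prod volume) := by
    refine ((integrable_fourier g).mul_prod hHi).mono hΦc.aestronglyMeasurable
      (Eventually.of_forall fun q => le_of_eq ?_)
    rw [Function.uncurry, hΦ]
    simp only [norm_mul, Complex.norm_exp_ofReal_mul_I, norm_wave, one_mul]
    ring
  have hsw := integral_integral_swap hΦi
  rw [mulOp, Real.fourierInv_eq']
  calc ∫ v : V n, Complex.exp (((2 * Real.pi * ⟪v, x⟫ : ℝ) : ℂ) * Complex.I) •
          (m v * 𝓕 (g : V n → ℂ) v)
      = ∫ v : V n, ∫ s, Φ v s := by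
        congr 1
        ext v
        rw [hm, smul_eq_mul, ← integral_mul_const, ← integral_const_mul]
        congr 1
        ext s
        simp only [hΦ, wave, mul_assoc]
        ring_nf
    _ = ∫ s, ∫ v : V n, Φ v s := hsw
    _ = ∫ s, H s * mulOp (wave (s * t)) g x := by
        congr 1
        ext s
        rw [mulOp, Real.fourierInv_eq', ← integral_const_mul]
        rfl

lemma exists_enorm_mulOp_edge_le {δ δ' : ℝ} (h0 : 0 < δ') (hδ : δ' < δ) :
    ∃ C : ℝ≥0∞, C ≠ ⊤ ∧ ∀ t ∈ Icc (1 : ℝ) 2, ∀ f g : 𝓢(V n, ℂ),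
      (∀ η, 𝓕 (g : V n → ℂ) η = (ann ‖η‖ : ℂ) * 𝓕 (f : V n → ℂ) η) → ∀ x,
      ‖mulOp (fun η => (edge δ (1 - t * ‖η‖) : ℂ)) f x‖ₑ ≤
        C * ∫⁻ τ, ENNReal.ofReal ((1 + |τ|) ^ (-(1 + δ'))) * ‖mulOp (wave τ) g x‖ₑ := by
  obtain ⟨H, C, hHc, hC0, hHb, hHi, hH⟩ := exists_edge_eq_integral h0 hδ
  refine ⟨ENNReal.ofReal (C * 2 ^ (1 + δ')), ENNReal.ofReal_ne_top, fun t ht f g hg x => ?_⟩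
  have ht0 : 0 < t := by linarith [ht.1]
  have e1 : mulOp (fun η => (edge δ (1 - t * ‖η‖) : ℂ)) f x =
      mulOp (fun η => (edge δ (1 - t * ‖η‖) : ℂ)) g x := by
    refine congrArg (fun F : V n → ℂ => 𝓕⁻ F x) (funext fun η => ?_)
    simp only [hg, ← mul_assoc]
    congr 1
    by_cases h1 : 1 - t * ‖η‖ ≤ 0
    · rw [edge_eq_zero_of_le h1, Complex.ofReal_zero, zero_mul]
    by_cases h2 : 3 / 4 ≤ 1 - t * ‖η‖
    · rw [edge_eq_zero_of_ge h2, Complex.ofReal_zero, zero_mul]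
    · rw [ann_eq_one, Complex.ofReal_one, mul_one]
      · nlinarith [ht.1, ht.2, norm_nonneg η]
      · nlinarith [ht.1, ht.2, norm_nonneg η]
  rw [e1, mulOp_eq_integral_wave hHc hHi (fun η => hH (t * ‖η‖))]
  refine (enorm_integral_le_lintegral_enorm _).trans ?_
  have h := lintegral_comp_smul_of_pos (volume : Measure ℝ)
    (fun τ => ‖H (t⁻¹ * τ)‖ₑ * ‖mulOp (wave τ) g x‖ₑ) ht0
  have e2 : (fun s : ℝ => ‖H s * mulOp (wave (s * t)) g x‖ₑ) =
      fun s => ‖H (t⁻¹ * (t • s))‖ₑ * ‖mulOp (wave (t • s)) g x‖ₑ := by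
    ext s
    rw [enorm_mul, smul_eq_mul, inv_mul_cancel_left₀ ht0.ne', mul_comm s t]
  rw [e2, h, Module.finrank_self, pow_one, ← lintegral_const_mul' _ _ ENNReal.ofReal_ne_top]
  rw [← lintegral_const_mul' _ _ ENNReal.ofReal_ne_top]
  refine lintegral_mono fun τ => ?_
  rw [← mul_assoc, ← mul_assoc]
  refine mul_le_mul' ?_ le_rfl
  rw [← ofReal_norm, ← ENNReal.ofReal_mul (by positivity), ← ENNReal.ofReal_mul (by positivity)]
  refine ENNReal.ofReal_le_ofReal ?_
  have hti : t⁻¹ ≤ 1 := inv_le_one_of_one_le₀ ht.1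
  have hti2 : 2⁻¹ ≤ t⁻¹ := inv_anti₀ ht0 ht.2
  have habs := abs_nonneg τ
  calc t⁻¹ * ‖H (t⁻¹ * τ)‖ ≤ 1 * (C * (1 + |t⁻¹ * τ|) ^ (-(1 + δ'))) := by
        gcongr
        exact hHb _
    _ ≤ 1 * (C * (2⁻¹ * (1 + |τ|)) ^ (-(1 + δ'))) := by
        refine mul_le_mul_of_nonneg_left (mul_le_mul_of_nonneg_left
          (Real.rpow_le_rpow_of_nonpos (by positivity) ?_ (by linarith)) hC0) zero_le_one
        rw [abs_mul, abs_of_pos (inv_pos.2 ht0)]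
        nlinarith
    _ = C * 2 ^ (1 + δ') * (1 + |τ|) ^ (-(1 + δ')) := by
        rw [Real.mul_rpow (by positivity) (by positivity), Real.inv_rpow (by positivity),
          Real.rpow_neg (by positivity) (1 + δ'), inv_inv]
        ring

lemma measurable_one_add_abs_rpow (e : ℝ) :
    Measurable fun τ : ℝ => ENNReal.ofReal ((1 + |τ|) ^ e) := by
  have : Continuous fun τ : ℝ => (1 + |τ|) ^ e :=
    (continuous_const.add continuous_abs).rpow_const fun τ =>
      Or.inl (by linarith [abs_nonneg τ] : 0 < 1 + |τ|).ne'
  exact this.measurable.ennreal_ofReal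

lemma measurable_weight_mul_wave (g : 𝓢(V n, ℂ)) (e q : ℝ) : Measurable fun z : V n × ℝ =>
    ENNReal.ofReal ((1 + |z.2|) ^ e) * ‖mulOp (wave z.2) g z.1‖ₑ ^ q := by
  have h1 : Measurable fun z : V n × ℝ => ‖mulOp (wave z.2) g z.1‖ₑ :=
    ((continuous_mulOp_wave g).comp continuous_swap).measurable.enorm
  have h2 : Measurable fun z : V n × ℝ => ENNReal.ofReal ((1 + |z.2|) ^ e) :=
    (measurable_one_add_abs_rpow e).comp measurable_snd
  exact h2.mul (h1.pow_const q)

lemma lintegral_weighted_wave_rpow_le {δ p β : ℝ} {K : ℝ≥0∞} (hK : K ≠ ⊤)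
    (h : ∀ φ : ℝ → ℝ≥0∞, Measurable φ →
      (∫⁻ τ, ENNReal.ofReal ((1 + |τ|) ^ (-(1 + δ))) * φ τ) ^ p ≤
        K * ∫⁻ τ, ENNReal.ofReal ((1 + |τ|) ^ (-1 - β)) * φ τ ^ p) (g : 𝓢(V n, ℂ)) :
    ∫⁻ x, (∫⁻ τ, ENNReal.ofReal ((1 + |τ|) ^ (-(1 + δ))) * ‖mulOp (wave τ) g x‖ₑ) ^ p ≤
      K * ∫⁻ τ, ENNReal.ofReal ((1 + |τ|) ^ (-1 - β)) * waveMass p g τ := by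
  have hm : ∀ x : V n, Measurable fun τ => ‖mulOp (wave τ) g x‖ₑ := fun x => by
    have := (continuous_mulOp_wave g).comp (Continuous.prodMk_left x)
    exact this.measurable.enorm
  calc ∫⁻ x, (∫⁻ τ, ENNReal.ofReal ((1 + |τ|) ^ (-(1 + δ))) * ‖mulOp (wave τ) g x‖ₑ) ^ p
      ≤ ∫⁻ x, K * ∫⁻ τ, ENNReal.ofReal ((1 + |τ|) ^ (-1 - β)) * ‖mulOp (wave τ) g x‖ₑ ^ p :=
        lintegral_mono fun x => h _ (hm x)
    _ = K * ∫⁻ x, (∫⁻ τ, ENNReal.ofReal ((1 + |τ|) ^ (-1 - β)) * ‖mulOp (wave τ) g x‖ₑ ^ p) :=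
        lintegral_const_mul' _ _ hK
    _ = K * ∫⁻ τ, (∫⁻ x, ENNReal.ofReal ((1 + |τ|) ^ (-1 - β)) * ‖mulOp (wave τ) g x‖ₑ ^ p) := by
        rw [lintegral_lintegral_swap (measurable_weight_mul_wave g _ _).aemeasurable]
    _ = K * ∫⁻ τ, ENNReal.ofReal ((1 + |τ|) ^ (-1 - β)) * waveMass p g τ := by
        congr 2
        ext τ
        rw [lintegral_const_mul' _ _ ENNReal.ofReal_ne_top, waveMass]

/-- Maximal bound for the singular part of the multiplier, for dilations in a
single dyadic block. -/
lemma exists_edge_maximal_block {δ δ' p β : ℝ} (h0 : 0 < δ') (hδ : δ' < δ) (hp : 1 < p)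
    (hβ : β < p * δ') {C₀ : ℝ≥0∞} (hC₀ : C₀ ≠ ⊤)
    (hW : ∀ g : 𝓢(V n, ℂ), AnnSupp g → ∫⁻ τ, ENNReal.ofReal ((1 + |τ|) ^ (-1 - β)) *
      waveMass p g τ ≤ C₀ * ∫⁻ x, ‖g x‖ₑ ^ p) :
    ∃ C : ℝ≥0∞, C ≠ ⊤ ∧ ∀ f : 𝓢(V n, ℂ), ∃ M : V n → ℝ≥0∞, Measurable M ∧
      (∀ t ∈ Icc (1 : ℝ) 2, ∀ x,
        ‖mulOp (fun η => (edge δ (1 - t * ‖η‖) : ℂ)) f x‖ₑ ≤ M x) ∧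
      ∫⁻ x, M x ^ p ≤ C * ∫⁻ x, ‖lpPiece 0 f x‖ₑ ^ p := by
  obtain ⟨C₁, hC₁, h1⟩ := exists_enorm_mulOp_edge_le (n := n) h0 hδ
  obtain ⟨K, hK, h2⟩ := exists_lintegral_weight_rpow_le hp hβ
  have hp0 : 0 ≤ p := by linarith
  refine ⟨C₁ ^ p * (K * C₀), ENNReal.mul_ne_top (ENNReal.rpow_ne_top_of_nonneg hp0 hC₁)
    (ENNReal.mul_ne_top hK hC₀), fun f => ?_⟩
  obtain ⟨g, hg1, hg2⟩ := exists_schwartz_mulOp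
    (contDiff_ann_radial (n := n) (s := 1) one_pos) (hasCompactSupport_ann_radial one_pos) f
  simp only [one_mul] at hg1 hg2
  have hgl : ∀ x, lpPiece 0 f x = g x := by
    intro x
    rw [hg1, lpPiece]
    simp only [zpow_zero, one_mul]
  have hgs : AnnSupp g := by
    intro η hη
    rw [hg2] at hη
    have hη' : (ann ‖η‖ : ℂ) ≠ 0 := left_ne_zero_of_mul hη
    constructor
    · by_contra! h
      exact hη' (by rw [ann_eq_zero_of_lt h.le, Complex.ofReal_zero])
    · by_contra! h
      exact hη' (by rw [ann_eq_zero_of_gt h.le, Complex.ofReal_zero])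
  refine ⟨fun x => C₁ * ∫⁻ τ, ENNReal.ofReal ((1 + |τ|) ^ (-(1 + δ'))) * ‖mulOp (wave τ) g x‖ₑ,
    ?_, fun t ht x => h1 t ht f g hg2 x, ?_⟩
  · refine Measurable.const_mul ?_ _
    have := (measurable_weight_mul_wave g (-(1 + δ')) 1).lintegral_prod_right' (ν := volume)
    simpa only [ENNReal.rpow_one] using this
  simp_rw [hgl, ENNReal.mul_rpow_of_nonneg _ _ hp0]
  rw [lintegral_const_mul' _ _ (ENNReal.rpow_ne_top_of_nonneg hp0 hC₁), mul_assoc, mul_assoc]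
  exact mul_le_mul' le_rfl ((lintegral_weighted_wave_rpow_le hK h2 g).trans
    (mul_le_mul' le_rfl (hW g hgs)))

lemma exists_edge_maximal_dyadic {δ p : ℝ} {C : ℝ≥0∞}
    (hB : ∀ f : 𝓢(V n, ℂ), ∃ M : V n → ℝ≥0∞, Measurable M ∧
      (∀ t ∈ Icc (1 : ℝ) 2, ∀ x,
        ‖mulOp (fun η => (edge δ (1 - t * ‖η‖) : ℂ)) f x‖ₑ ≤ M x) ∧
      ∫⁻ x, M x ^ p ≤ C * ∫⁻ x, ‖lpPiece 0 f x‖ₑ ^ p) (k : ℤ) (f : 𝓢(V n, ℂ)) :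
    ∃ M : V n → ℝ≥0∞, Measurable M ∧
      (∀ t ∈ Icc ((2 : ℝ) ^ k) (2 ^ (k + 1)), ∀ x,
        ‖mulOp (fun η => (edge δ (1 - t * ‖η‖) : ℂ)) f x‖ₑ ≤ M x) ∧
      ∫⁻ x, M x ^ p ≤ C * ∫⁻ x, ‖lpPiece k f x‖ₑ ^ p := by
  set s : ℝ := 2 ^ k with hs
  have hs0 : 0 < s := by positivity
  obtain ⟨g, hg⟩ := exists_schwartz_dilate f hs0
  obtain ⟨M, hMm, hM1, hM2⟩ := hB g
  refine ⟨fun x => M (s⁻¹ • x), hMm.comp (measurable_const_smul _), fun t ht x => ?_, ?_⟩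
  · have ht' : t / s ∈ Icc (1 : ℝ) 2 := by
      rw [zpow_add₀ two_ne_zero, zpow_one, ← hs] at ht
      rw [mem_Icc, le_div_iff₀ hs0, div_le_iff₀ hs0]
      constructor <;> linarith [ht.1, ht.2]
    have h := hM1 (t / s) ht' (s⁻¹ • x)
    rw [mulOp_comp_smul _ f g hs0 hg, smul_inv_smul₀ hs0.ne'] at h
    refine le_trans (le_of_eq ?_) h
    congr 2
    ext η
    rw [norm_smul, Real.norm_of_nonneg hs0.le, ← mul_assoc, div_mul_cancel₀ _ hs0.ne']
  · have hl : ∀ x, lpPiece 0 g x = lpPiece k f (s • x) := by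
      intro x
      rw [lpPiece, lpPiece, mulOp_comp_smul _ f g hs0 hg]
      congr 1
      ext η
      rw [norm_smul, Real.norm_of_nonneg hs0.le, zpow_zero, one_mul]
    simp_rw [hl] at hM2
    have h1 := lintegral_comp_smul_of_pos (volume : Measure (V n)) (fun x => M (s⁻¹ • x) ^ p) hs0
    have h2 := lintegral_comp_smul_of_pos (volume : Measure (V n))
      (fun x => ‖lpPiece k f x‖ₑ ^ p) hs0
    simp_rw [inv_smul_smul₀ hs0.ne'] at h1
    rw [h1, h2, mul_left_comm] at hM2
    refine (ENNReal.mul_le_mul_iff_right ?_ ENNReal.ofReal_ne_top).1 hM2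
    rw [Ne, ENNReal.ofReal_eq_zero, not_le]
    positivity

/-- The maximal bound for the singular part of the multiplier. -/
lemma exists_edge_maximal {δ p : ℝ} (hp : 2 < p) {C : ℝ≥0∞} (hC : C ≠ ⊤)
    (hB : ∀ f : 𝓢(V n, ℂ), ∃ M : V n → ℝ≥0∞, Measurable M ∧
      (∀ t ∈ Icc (1 : ℝ) 2, ∀ x,
        ‖mulOp (fun η => (edge δ (1 - t * ‖η‖) : ℂ)) f x‖ₑ ≤ M x) ∧
      ∫⁻ x, M x ^ p ≤ C * ∫⁻ x, ‖lpPiece 0 f x‖ₑ ^ p) :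
    ∃ C' : ℝ≥0∞, C' ≠ ⊤ ∧ ∀ f : 𝓢(V n, ℂ), ∃ M : V n → ℝ≥0∞, Measurable M ∧
      (∀ t : ℝ, 0 < t → ∀ x,
        ‖mulOp (fun η => (edge δ (1 - t * ‖η‖) : ℂ)) f x‖ₑ ≤ M x) ∧
      ∫⁻ x, M x ^ p ≤ C' * ∫⁻ x, ‖f x‖ₑ ^ p := by
  obtain ⟨C₂, hC₂, h2⟩ := exists_tsum_lintegral_lpPiece_le (n := n) hp
  have hp0 : 0 < p := by linarith
  refine ⟨C * C₂, ENNReal.mul_ne_top hC hC₂, fun f => ?_⟩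
  choose M hMm hM1 hM2 using fun k => exists_edge_maximal_dyadic hB k f
  refine ⟨fun x => (∑' k, M k x ^ p) ^ p⁻¹, ?_, fun t ht x => ?_, ?_⟩
  · exact (Measurable.tsum fun k => (hMm k).pow_const p).pow_const _
  · obtain ⟨k, hk⟩ := exists_mem_Ico_zpow ht (one_lt_two (α := ℝ))
    rw [ENNReal.le_rpow_inv_iff hp0]
    exact (ENNReal.rpow_le_rpow (hM1 k t (Ico_subset_Icc_self hk) x) hp0.le).trans
      (ENNReal.le_tsum k)
  · simp_rw [← ENNReal.rpow_mul, inv_mul_cancel₀ hp0.ne', ENNReal.rpow_one]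
    rw [lintegral_tsum fun k => ((hMm k).pow_const p).aemeasurable]
    calc ∑' k, ∫⁻ x, M k x ^ p ≤ ∑' k, C * ∫⁻ x, ‖lpPiece k f x‖ₑ ^ p :=
          ENNReal.tsum_le_tsum hM2
      _ = C * ∑' k, ∫⁻ x, ‖lpPiece k f x‖ₑ ^ p := ENNReal.tsum_mul_left
      _ ≤ C * (C₂ * ∫⁻ x, ‖f x‖ₑ ^ p) := by
          gcongr
          exact h2 f
      _ = _ := by ring

lemma integrable_mulOp_integrand {m : V n → ℂ} {B : ℝ} (hm : AEStronglyMeasurable m)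
    (hB : ∀ η, ‖m η‖ ≤ B) (f : 𝓢(V n, ℂ)) (x : V n) :
    Integrable fun η => Complex.exp (((2 * Real.pi * ⟪η, x⟫ : ℝ) : ℂ) * Complex.I) •
      (m η * 𝓕 (f : V n → ℂ) η) := by
  have hi : Integrable (fun η => m η * 𝓕 (f : V n → ℂ) η) :=
    (integrable_fourier f).bdd_mul hm (Eventually.of_forall hB)
  refine hi.bdd_mul (c := 1) (Continuous.aestronglyMeasurable (by fun_prop))
    (Eventually.of_forall fun η => ?_)
  rw [Complex.norm_exp_ofReal_mul_I]

lemma mulOp_add {m m' : V n → ℂ} {B B' : ℝ} (hm : AEStronglyMeasurable m)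
    (hB : ∀ η, ‖m η‖ ≤ B) (hm' : AEStronglyMeasurable m') (hB' : ∀ η, ‖m' η‖ ≤ B')
    (f : 𝓢(V n, ℂ)) (x : V n) :
    mulOp (fun η => m η + m' η) f x = mulOp m f x + mulOp m' f x := by
  simp only [mulOp, Real.fourierInv_eq']
  rw [← integral_add (integrable_mulOp_integrand hm hB f x)
    (integrable_mulOp_integrand hm' hB' f x)]
  refine integral_congr_ae (Eventually.of_forall fun η => ?_)
  simp only [add_mul, smul_add]

lemma enorm_mulOp_le_tsum_of_hasSum {m : V n → ℂ} {μ : ℕ → V n → ℂ} {B : ℕ → ℝ}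
    (hBs : Summable B) (hμ : ∀ k, Continuous (μ k)) (hB : ∀ k η, ‖μ k η‖ ≤ B k)
    (hs : ∀ η, HasSum (fun k => μ k η) (m η)) (f : 𝓢(V n, ℂ)) (x : V n) :
    ‖mulOp m f x‖ₑ ≤ ∑' k, ‖mulOp (μ k) f x‖ₑ := by
  have hsum := hasSum_integral_of_summable_integral_norm (μ := (volume : Measure (V n)))
    (fun k => integrable_mulOp_integrand (hμ k).aestronglyMeasurable (hB k) f x) ?_
  · have e : (∫ η : V n, ∑' k, Complex.exp (((2 * Real.pi * ⟪η, x⟫ : ℝ) : ℂ) * Complex.I) •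
        (μ k η * 𝓕 (f : V n → ℂ) η)) = mulOp m f x := by
      rw [mulOp, Real.fourierInv_eq']
      refine integral_congr_ae (Eventually.of_forall fun η => ?_)
      exact (((hs η).mul_right _).const_smul _).tsum_eq
    rw [e] at hsum
    rw [← hsum.tsum_eq]
    refine enorm_tsum_le_tsum_enorm.trans (le_of_eq ?_)
    simp only [mulOp, Real.fourierInv_eq']
  · refine Summable.of_nonneg_of_le (fun k => integral_nonneg fun η => norm_nonneg _) (fun k => ?_)
      (hBs.mul_right (∫ η : V n, ‖𝓕 (f : V n → ℂ) η‖))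
    rw [← integral_const_mul]
    refine integral_mono
      (integrable_mulOp_integrand (hμ k).aestronglyMeasurable (hB k) f x).norm
      ((integrable_fourier f).norm.const_mul _) fun η => ?_
    simp only [norm_smul, Complex.norm_exp_ofReal_mul_I, one_mul, norm_mul]
    exact mul_le_mul_of_nonneg_right (hB k η) (norm_nonneg _)

/-- The nonconstant low-frequency part of the profile `(1 - r)₊^δ`. -/
def core (δ r : ℝ) : ℝ := (posRpow (1 - r) δ - 1) * cut r

lemma core_zero (δ : ℝ) : core δ 0 = 0 := by
  rw [core, posRpow, if_pos (by norm_num)]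
  norm_num

lemma core_eq_zero {δ r : ℝ} (h : 1 / 2 ≤ r) : core δ r = 0 := by
  rw [core, cut_eq_zero h, mul_zero]

lemma contDiff_core (δ : ℝ) : ContDiff ℝ ∞ (core δ) := by
  rw [contDiff_iff_contDiffAt]
  intro r
  rcases lt_or_ge r 1 with hr | hr
  · have h1 : ContDiffAt ℝ ∞ (fun u : ℝ => u ^ δ) (1 - r) :=
      Real.contDiffAt_rpow_const_of_ne (by linarith : 0 < 1 - r).ne'
    have h2 : ContDiffAt ℝ ∞ (fun r : ℝ => 1 - r) r := by fun_prop
    have h3 := h1.comp r h2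
    refine ((h3.sub (contDiffAt_const (c := (1 : ℝ)))).mul
      contDiff_cut.contDiffAt).congr_of_eventuallyEq ?_
    filter_upwards [gt_mem_nhds hr] with v hv
    rw [core, posRpow, if_pos (by linarith)]
    rfl
  · refine (contDiffAt_const (c := (0 : ℝ))).congr_of_eventuallyEq ?_
    filter_upwards [lt_mem_nhds (show 1 / 2 < r by linarith)] with v hv
    exact core_eq_zero hv.le

lemma analyticAt_core (δ : ℝ) : AnalyticAt ℝ (core δ) 0 := by
  have h1 : AnalyticAt ℝ (fun u : ℝ => u ^ δ) (1 - 0) :=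
    (Real.contDiffAt_rpow_const_of_ne (n := ω) (by norm_num)).analyticAt
  have h2 : AnalyticAt ℝ (fun r : ℝ => 1 - r) 0 := by fun_prop
  have h3 : AnalyticAt ℝ (fun r : ℝ => (1 - r) ^ δ) 0 := AnalyticAt.fun_comp h1 h2
  refine (h3.sub (analyticAt_const (v := (1 : ℝ)))).congr ?_
  filter_upwards [gt_mem_nhds (show (0 : ℝ) < 1 / 4 by norm_num)] with v hv
  rw [core, posRpow, if_pos (by linarith), cut_eq_one hv.le, mul_one]
  rfl

lemma contDiff_dslope_core (δ : ℝ) : ContDiff ℝ ∞ (dslope (core δ) 0) := by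
  rw [contDiff_iff_contDiffAt]
  intro r
  by_cases hr : r = 0
  · subst hr
    obtain ⟨P, hP⟩ := analyticAt_core δ
    exact hP.has_fpower_series_dslope_fslope.analyticAt.contDiffAt
  · have h1 : ContDiffAt ℝ ∞ (fun r => r⁻¹ * core δ r) r :=
      (contDiffAt_inv ℝ hr).mul (contDiff_core δ).contDiffAt
    refine h1.congr_of_eventuallyEq ?_
    filter_upwards [isOpen_ne.mem_nhds hr] with v hv
    rw [dslope_of_ne _ hv, slope_def_field, core_zero]
    ring

/-- The rescaled dyadic pieces of `core`, as a smooth function of scale and radius. -/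
def corePiece (δ : ℝ) (q : ℝ × ℝ) : ℝ :=
  bump q.1 * q.2 * dslope (core δ) 0 (q.1 * q.2) * (cut (q.2 / 4) - cut (q.2 / 2))

lemma contDiff_corePiece (δ : ℝ) : ContDiff ℝ ∞ (corePiece δ) := by
  have h1 : ContDiff ℝ ∞ fun q : ℝ × ℝ => bump q.1 := contDiff_bump.comp contDiff_fst
  have h2 : ContDiff ℝ ∞ fun q : ℝ × ℝ => dslope (core δ) 0 (q.1 * q.2) :=
    (contDiff_dslope_core δ).comp (contDiff_fst.mul contDiff_snd)
  have h3 : ContDiff ℝ ∞ fun q : ℝ × ℝ => cut (q.2 / 4) - cut (q.2 / 2) :=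
    (contDiff_cut.comp (contDiff_snd.div_const 4)).sub
      (contDiff_cut.comp (contDiff_snd.div_const 2))
  exact ((h1.mul contDiff_snd).mul h2).mul h3

lemma corePiece_eq_zero_of_lt {δ e r : ℝ} (h : r ≤ 1 / 2) : corePiece δ (e, r) = 0 := by
  simp only [corePiece]
  rw [cut_eq_one (by linarith), cut_eq_one (by linarith), sub_self, mul_zero]

lemma corePiece_eq_zero_of_gt {δ e r : ℝ} (h : 2 < |e| ∨ 2 < r) : corePiece δ (e, r) = 0 := by
  simp only [corePiece]
  rcases h with h | h
  · rw [bump_eq_zero h]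
    ring
  · rw [cut_eq_zero (by linarith), cut_eq_zero (by linarith), sub_self, mul_zero]

lemma hasSum_corePiece (δ : ℝ) {r : ℝ} (hr : 0 ≤ r) :
    HasSum (fun k : ℕ => (1 / 2 : ℝ) ^ k * corePiece δ ((1 / 2) ^ k, 2 ^ k * r)) (core δ r) := by
  have hterm : ∀ k : ℕ, (1 / 2 : ℝ) ^ k * corePiece δ ((1 / 2) ^ k, 2 ^ k * r) =
      core δ r * (cut (2 ^ k * r / 4) - cut (2 ^ (k + 1) * r / 4)) := by
    intro k
    have e1 : (1 / 2 : ℝ) ^ k * (2 ^ k * r) = r := by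
      rw [← mul_assoc, ← mul_pow]
      norm_num
    have e2 : bump ((1 / 2 : ℝ) ^ k) = 1 := by
      apply bump_eq_one
      rw [abs_of_pos (by positivity)]
      exact pow_le_one₀ (by norm_num) (by norm_num)
    have e3 : r * dslope (core δ) 0 r = core δ r := by
      have := sub_smul_dslope (core δ) 0 r
      rwa [sub_zero, core_zero, sub_zero, smul_eq_mul] at this
    have e4 : (2 : ℝ) ^ (k + 1) * r / 4 = 2 ^ k * r / 2 := by ring
    simp only [corePiece]
    rw [e1, e2, e4, ← e3, one_mul, ← mul_assoc, ← mul_assoc, e1]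
  simp_rw [hterm]
  rcases hr.eq_or_lt with h0 | h0
  · rw [← h0, core_zero]
    simp
  obtain ⟨K, hK⟩ := pow_unbounded_of_one_lt (2 * r⁻¹) (one_lt_two (α := ℝ))
  have hbig : ∀ k, K ≤ k → cut (2 ^ k * r / 4) = 0 := by
    intro k hk
    apply cut_eq_zero
    have h1 : (2 : ℝ) ^ K ≤ 2 ^ k := pow_le_pow_right₀ (by norm_num) hk
    have h2 : 2 * r⁻¹ * r < 2 ^ k * r := mul_lt_mul_of_pos_right (hK.trans_le h1) h0
    rw [inv_mul_cancel_right₀ h0.ne'] at h2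
    linarith
  have h := hasSum_sum_of_ne_finset_zero (L := .unconditional ℕ) (s := Finset.range K)
    (f := fun k : ℕ => core δ r * (cut (2 ^ k * r / 4) - cut (2 ^ (k + 1) * r / 4)))
    (fun k hk => by
      have hk' : K ≤ k := by simpa using hk
      rw [hbig k hk', hbig (k + 1) (by omega), sub_self, mul_zero])
  rw [← Finset.mul_sum, Finset.sum_range_sub' (fun k : ℕ => cut (2 ^ k * r / 4)), hbig K le_rfl,
    pow_zero, one_mul, sub_zero] at h
  rcases le_or_gt r 1 with h1 | h1
  · rwa [cut_eq_one (by linarith), mul_one] at h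
  · rw [core_eq_zero (by linarith)] at h ⊢
    rwa [zero_mul] at h

lemma exists_enorm_mulOp_core_le (δ : ℝ) :
    ∃ C : ℝ≥0∞, C ≠ ⊤ ∧ ∀ t : ℝ, 0 < t → ∀ (f : 𝓢(V n, ℂ)) (x : V n),
      ‖mulOp (fun η => (core δ (t * ‖η‖) : ℂ)) f x‖ₑ ≤ C * maxFn (fun y => ‖f y‖ₑ) x := by
  have hsm : ContDiff ℝ ∞ (fun q : ℝ × ℝ => (corePiece δ q : ℂ)) :=
    Complex.ofRealCLM.contDiff.comp (contDiff_corePiece δ)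
  obtain ⟨C, hC, hb⟩ := exists_enorm_mulOp_radial_le (n := n) hsm (r₀ := 1 / 2) (by norm_num)
    (fun e r hr => by
      rw [corePiece_eq_zero_of_lt hr.le, corePiece_eq_zero_of_lt (by norm_num)])
    (R := 2) (fun e r h => by rw [corePiece_eq_zero_of_gt h, Complex.ofReal_zero])
  have hcs : HasCompactSupport (corePiece δ) := by
    refine HasCompactSupport.intro (K := Icc (-2) 2 ×ˢ Icc 0 2)
      (isCompact_Icc.prod isCompact_Icc) fun q hq => ?_
    by_contra hne
    apply hq
    have h1 : |q.1| ≤ 2 := by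
      by_contra! h
      exact hne (corePiece_eq_zero_of_gt (Or.inl h))
    have h2 : q.2 ≤ 2 := by
      by_contra! h
      exact hne (corePiece_eq_zero_of_gt (Or.inr h))
    have h3 : 1 / 2 < q.2 := by
      by_contra! h
      exact hne (corePiece_eq_zero_of_lt h)
    exact ⟨abs_le.1 h1, by linarith, h2⟩
  obtain ⟨B, hB⟩ := hcs.exists_bound_of_continuous (contDiff_corePiece δ).continuous
  refine ⟨(∑' k : ℕ, ENNReal.ofReal ((1 / 2) ^ k)) * C, ENNReal.mul_ne_top ?_ hC,
    fun t ht f x => ?_⟩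
  · rw [← ENNReal.ofReal_tsum_of_nonneg (fun j => by positivity) summable_geometric_two]
    exact ENNReal.ofReal_ne_top
  have h := enorm_mulOp_le_tsum_of_hasSum (n := n) (m := fun η => (core δ (t * ‖η‖) : ℂ))
    (μ := fun k η => (((1 / 2 : ℝ) ^ k : ℝ) : ℂ) *
      (corePiece δ ((1 / 2) ^ k, 2 ^ k * t * ‖η‖) : ℂ))
    (B := fun k => (1 / 2 : ℝ) ^ k * B) (summable_geometric_two.mul_right B) ?_ ?_ ?_ f x
  · refine h.trans ?_
    rw [← ENNReal.tsum_mul_right, ← ENNReal.tsum_mul_right]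
    refine ENNReal.tsum_le_tsum fun k => ?_
    rw [mulOp_const_mul, enorm_mul, mul_assoc]
    refine mul_le_mul' (le_of_eq ?_) (hb _ _ (by positivity) f x)
    rw [← ofReal_norm, Complex.norm_real, Real.norm_of_nonneg (by positivity)]
  · intro k
    have h1 := (contDiff_corePiece δ).continuous
    have h2 : Continuous fun η : V n => ((1 / 2 : ℝ) ^ k, 2 ^ k * t * ‖η‖) := by fun_prop
    exact continuous_const.mul (Complex.continuous_ofReal.comp (h1.comp h2))
  · intro k η
    rw [norm_mul, Complex.norm_real, Complex.norm_real, Real.norm_of_nonneg (by positivity)]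
    gcongr
    exact hB _
  · intro η
    have h1 := Complex.hasSum_ofReal.2 (hasSum_corePiece δ (by positivity : 0 ≤ t * ‖η‖))
    simpa only [Complex.ofReal_mul, mul_assoc] using h1

lemma abs_posRpow_le_one {δ u : ℝ} (hδ : 0 ≤ δ) (hu : u ≤ 1) : |posRpow u δ| ≤ 1 := by
  rw [posRpow]
  split_ifs with h
  · rw [abs_of_nonneg (by positivity)]
    exact Real.rpow_le_one h.le hu hδ
  · simp

lemma bochnerRiesz_profile_eq (δ r : ℝ) :
    posRpow (1 - r) δ = edge δ (1 - r) + (core δ r + cut r) := by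
  rw [edge, core, sub_sub_cancel]
  ring

lemma mulOp_posRpow_eq {δ : ℝ} (hδ : 0 < δ) {t : ℝ} (ht : 0 < t) (f : 𝓢(V n, ℂ)) (x : V n) :
    mulOp (fun η => (posRpow (1 - t * ‖η‖) δ : ℂ)) f x =
      mulOp (fun η => (edge δ (1 - t * ‖η‖) : ℂ)) f x +
        (mulOp (fun η => (core δ (t * ‖η‖) : ℂ)) f x +
          mulOp (fun η => (cut (t * ‖η‖) : ℂ)) f x) := by
  have hr : ∀ η : V n, 1 - t * ‖η‖ ≤ 1 := fun η => by
    have : 0 ≤ t * ‖η‖ := by positivity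
    linarith
  have hcutb : ∀ r, |cut r| ≤ 1 := fun r => by
    rw [abs_of_nonneg (cut_nonneg r)]
    exact cut_le_one r
  have h1c : Continuous fun η : V n => (edge δ (1 - t * ‖η‖) : ℂ) := by
    have := (continuous_edge hδ).comp (by fun_prop : Continuous fun η : V n => 1 - t * ‖η‖)
    exact Complex.continuous_ofReal.comp this
  have h2c : Continuous fun η : V n => (core δ (t * ‖η‖) : ℂ) := by
    have := (contDiff_core δ).continuous.comp (by fun_prop : Continuous fun η : V n => t * ‖η‖)
    exact Complex.continuous_ofReal.comp this
  have h3c : Continuous fun η : V n => (cut (t * ‖η‖) : ℂ) := by fun_prop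
  have h1b : ∀ η : V n, ‖(edge δ (1 - t * ‖η‖) : ℂ)‖ ≤ 1 := fun η => by
    rw [Complex.norm_real, Real.norm_eq_abs, edge, abs_mul]
    refine mul_le_one₀ (abs_posRpow_le_one hδ.le (hr η)) (abs_nonneg _) ?_
    rw [abs_le]
    constructor <;> linarith [cut_nonneg (1 - (1 - t * ‖η‖)), cut_le_one (1 - (1 - t * ‖η‖))]
  have h2b : ∀ η : V n, ‖(core δ (t * ‖η‖) : ℂ)‖ ≤ 2 := fun η => by
    rw [Complex.norm_real, Real.norm_eq_abs, core, abs_mul]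
    have h := abs_sub (posRpow (1 - t * ‖η‖) δ) 1
    rw [abs_one] at h
    nlinarith [abs_posRpow_le_one hδ.le (hr η), hcutb (t * ‖η‖), abs_nonneg (cut (t * ‖η‖)),
      abs_nonneg (posRpow (1 - t * ‖η‖) δ - 1)]
  have h3b : ∀ η : V n, ‖(cut (t * ‖η‖) : ℂ)‖ ≤ 1 := fun η => by
    rw [Complex.norm_real]
    exact hcutb _
  have h23c : Continuous fun η : V n => (core δ (t * ‖η‖) : ℂ) + (cut (t * ‖η‖) : ℂ) := h2c.add h3c
  rw [← mulOp_add h2c.aestronglyMeasurable h2b h3c.aestronglyMeasurable h3b,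
    ← mulOp_add (B' := 3) h1c.aestronglyMeasurable h1b h23c.aestronglyMeasurable]
  · simp_rw [bochnerRiesz_profile_eq, Complex.ofReal_add]
  · exact fun η => (norm_add_le _ _).trans (by linarith [h2b η, h3b η])

lemma exists_enorm_mulOp_cut_le :
    ∃ C : ℝ≥0∞, C ≠ ⊤ ∧ ∀ t : ℝ, 0 < t → ∀ (f : 𝓢(V n, ℂ)) (x : V n),
      ‖mulOp (fun η => (cut (t * ‖η‖) : ℂ)) f x‖ₑ ≤ C * maxFn (fun y => ‖f y‖ₑ) x :=
  exists_enorm_mulOp_radial_le_single (b := fun r => (cut r : ℂ))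
    (Complex.ofRealCLM.contDiff.comp contDiff_cut) (r₀ := 1 / 4) (by norm_num)
    (fun r hr => by rw [cut_eq_one hr.le, cut_eq_one (by norm_num)]) (R := 1 / 2)
    (fun r hr => by rw [cut_eq_zero hr.le, Complex.ofReal_zero])

lemma eLpNorm_ofReal_rpow {p : ℝ} (hp : 0 < p) (g : V n → ℂ) :
    eLpNorm g (ENNReal.ofReal p) volume ^ p = ∫⁻ x, ‖g x‖ₑ ^ p := by
  rw [eLpNorm_eq_lintegral_rpow_enorm_toReal (by simpa using hp) ENNReal.ofReal_ne_top,
    ENNReal.toReal_ofReal hp.le, ← ENNReal.rpow_mul, one_div_mul_cancel hp.ne', ENNReal.rpow_one]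

lemma lintegral_add_mul_rpow_le {p : ℝ} (hp : 1 ≤ p) {M F : V n → ℝ≥0∞} (hM : Measurable M)
    {D : ℝ≥0∞} (hD : D ≠ ⊤) :
    ∫⁻ x, (M x + D * F x) ^ p ≤
      2 ^ (p - 1) * (∫⁻ x, M x ^ p) + 2 ^ (p - 1) * D ^ p * ∫⁻ x, F x ^ p := by
  have hF : ∀ x, (M x + D * F x) ^ p ≤
      2 ^ (p - 1) * M x ^ p + 2 ^ (p - 1) * D ^ p * F x ^ p := fun x => by
    refine (ENNReal.rpow_add_le_mul_rpow_add_rpow _ _ hp).trans_eq ?_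
    rw [ENNReal.mul_rpow_of_nonneg _ _ (by linarith)]
    ring
  have h2 : (2 : ℝ≥0∞) ^ (p - 1) ≠ ⊤ :=
    ENNReal.rpow_ne_top_of_nonneg (by linarith) ENNReal.ofNat_ne_top
  refine (lintegral_mono hF).trans_eq ?_
  rw [lintegral_add_left ((hM.pow_const p).const_mul _), lintegral_const_mul' _ _ h2,
    lintegral_const_mul' _ _ (ENNReal.mul_ne_top h2
      (ENNReal.rpow_ne_top_of_nonneg (by linarith) hD))]

end LocalSmoothing

/-- for `n ≥ 2` and `2n/(n−1) ≤ p < ∞`, `1/p−` local smoothing for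
`e^{it√(−Δ)}` implies the maximal Bochner–Riesz estimate
`(∫ sup_{t>0} |S_t^δ f(x)|^p dx)^{1/p} ≤ C‖f‖_{L^p}` for all `δ > δ(p)`. -/
theorem local_smoothing_implies_maximal_bochner_riesz (n : ℕ) (hn : 2 ≤ n) (p : ℝ)
    (hp : 2 * n / (n - 1) ≤ p)
    (hLS : ∀ σ : ℝ, σ < 1 / p →
      ∃ C : ℝ, ∀ f : SchwartzMap (V n) ℂ,
        (∫⁻ t in Set.Icc (1 : ℝ) 2,
            (eLpNorm (besselD (σ - sBar n p) (halfWave t ⇑f)) (ENNReal.ofReal p) volume)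
              ^ p) ^ (1 / p)
          ≤ ENNReal.ofReal C * eLpNorm (⇑f) (ENNReal.ofReal p) volume) :
    ∀ δ : ℝ, n * (1 / 2 - 1 / p) - 1 / 2 < δ →
      ∃ C : ℝ, ∀ f : SchwartzMap (V n) ℂ,
        (∫⁻ x : V n,
            (⨆ t : {t : ℝ // 0 < t}, (‖bochnerRiesz δ (t : ℝ) (⇑f) x‖₊ : ℝ≥0∞)) ^ p)
          ^ (1 / p)
          ≤ ENNReal.ofReal C * eLpNorm (⇑f) (ENNReal.ofReal p) volume := by
  intro δ hδ
  have hn' : (2 : ℝ) ≤ n := by exact_mod_cast hn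
  have hp2 : 2 < p := by
    refine lt_of_lt_of_le ?_ hp
    rw [lt_div_iff₀ (by linarith)]
    linarith
  have hp0 : 0 < p := by linarith
  have hcrit : 0 ≤ n * (1 / 2 - 1 / p) - 1 / 2 := by
    rw [div_le_iff₀ (by linarith)] at hp
    have h1 : n * (1 / 2 - 1 / p) - 1 / 2 = (p * (n - 1) - 2 * n) / (2 * p) := by
      field_simp
      ring
    rw [h1]
    exact div_nonneg (by linarith) (by linarith)
  have hs : sBar n p - 1 / p = n * (1 / 2 - 1 / p) - 1 / 2 := by
    have : 1 / p ≤ 1 / 2 := one_div_le_one_div_of_le (by norm_num) hp2.le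
    rw [sBar, abs_of_nonneg (by linarith)]
    ring
  obtain ⟨a, ha, haδ⟩ := exists_between hδ
  obtain ⟨δ', haδ', hδ'⟩ := exists_between haδ
  obtain ⟨β, haβ, hβ⟩ := exists_between (mul_lt_mul_of_pos_right haδ' hp0)
  obtain ⟨C₁, hC₁⟩ := hLS (sBar n p - a) (by linarith)
  have hLS' : ∀ f : SchwartzMap (V n) ℂ, ∫⁻ t in Set.Icc (1 : ℝ) 2,
      ∫⁻ x, ‖besselD (-a) (halfWave t ⇑f) x‖ₑ ^ p ≤
        ENNReal.ofReal C₁ ^ p * ∫⁻ x, ‖f x‖ₑ ^ p := by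
    intro f
    have h := ENNReal.rpow_le_rpow (hC₁ f) hp0.le
    rw [← ENNReal.rpow_mul, one_div_mul_cancel hp0.ne', ENNReal.rpow_one,
      ENNReal.mul_rpow_of_nonneg _ _ hp0.le, sub_sub_cancel_left] at h
    simpa only [LocalSmoothing.eLpNorm_ofReal_rpow hp0] using h
  have ha0 : 0 < a := hcrit.trans_lt ha
  have hβ0 : 0 ≤ β := (mul_nonneg ha0.le hp0.le).trans haβ.le
  obtain ⟨C₂, hC₂, hW⟩ := LocalSmoothing.exists_weighted_waveMass_le (by omega)
    (by linarith) hβ0 haβ (ENNReal.rpow_ne_top_of_nonneg hp0.le ENNReal.ofReal_ne_top) hLS'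
  obtain ⟨C₃, hC₃, hB⟩ := LocalSmoothing.exists_edge_maximal_block (ha0.trans haδ') hδ'
    (by linarith) (by linarith) hC₂ hW
  obtain ⟨C₄, hC₄, hE⟩ := LocalSmoothing.exists_edge_maximal hp2 hC₃ hB
  obtain ⟨C₅, hC₅, hcore⟩ := LocalSmoothing.exists_enorm_mulOp_core_le (n := n) δ
  obtain ⟨C₆, hC₆, hcut⟩ := LocalSmoothing.exists_enorm_mulOp_cut_le (n := n)
  obtain ⟨C₇, hC₇, hmax⟩ := LocalSmoothing.lintegral_maxFn_rpow_le (n := n) (by omega)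
    (show 1 < p by linarith)
  set K : ℝ≥0∞ := 2 ^ (p - 1) * C₄ + 2 ^ (p - 1) * (C₅ + C₆) ^ p * C₇ with hK
  have hD : C₅ + C₆ ≠ ⊤ := ENNReal.add_ne_top.2 ⟨hC₅, hC₆⟩
  have hKtop : K ≠ ⊤ := by
    have h2 : (2 : ℝ≥0∞) ^ (p - 1) ≠ ⊤ :=
      ENNReal.rpow_ne_top_of_nonneg (by linarith) ENNReal.ofNat_ne_top
    exact ENNReal.add_ne_top.2 ⟨ENNReal.mul_ne_top h2 hC₄, ENNReal.mul_ne_top (ENNReal.mul_ne_top h2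
      (ENNReal.rpow_ne_top_of_nonneg hp0.le hD)) hC₇⟩
  refine ⟨(K ^ (1 / p)).toReal, fun f => ?_⟩
  obtain ⟨M, hM, hdom, hMint⟩ := hE f
  have hpt : ∀ x, (⨆ t : {t : ℝ // 0 < t}, (‖bochnerRiesz δ (t : ℝ) (⇑f) x‖₊ : ℝ≥0∞)) ≤
      M x + (C₅ + C₆) * LocalSmoothing.maxFn (fun y => ‖f y‖ₑ) x := by
    intro x
    refine iSup_le fun ⟨t, ht⟩ => ?_
    have hT : 0 < t * (2 * Real.pi) := by positivity
    change ‖bochnerRiesz δ t (⇑f) x‖ₑ ≤ _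
    rw [LocalSmoothing.bochnerRiesz_eq_mulOp,
      LocalSmoothing.mulOp_posRpow_eq ((ha0.trans haδ').trans hδ') hT, add_mul]
    exact (enorm_add_le _ _).trans (add_le_add (hdom _ hT x)
      ((enorm_add_le _ _).trans (add_le_add (hcore _ hT f x) (hcut _ hT f x))))
  rw [ENNReal.ofReal_toReal (ENNReal.rpow_ne_top_of_nonneg (by positivity) hKtop)]
  have hmain : ∫⁻ x : V n, (⨆ t : {t : ℝ // 0 < t}, (‖bochnerRiesz δ (t : ℝ) (⇑f) x‖₊ : ℝ≥0∞)) ^ p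
      ≤ K * eLpNorm (⇑f) (ENNReal.ofReal p) volume ^ p := by
    rw [LocalSmoothing.eLpNorm_ofReal_rpow hp0]
    calc _ ≤ ∫⁻ x, (M x + (C₅ + C₆) * LocalSmoothing.maxFn (fun y => ‖f y‖ₑ) x) ^ p :=
          lintegral_mono fun x => ENNReal.rpow_le_rpow (hpt x) hp0.le
      _ ≤ _ := LocalSmoothing.lintegral_add_mul_rpow_le (by linarith) hM hD
      _ ≤ 2 ^ (p - 1) * (C₄ * ∫⁻ x, ‖f x‖ₑ ^ p) +
          2 ^ (p - 1) * (C₅ + C₆) ^ p * (C₇ * ∫⁻ x, ‖f x‖ₑ ^ p) :=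
        add_le_add (mul_le_mul' le_rfl hMint)
          (mul_le_mul' le_rfl (hmax _ f.continuous.enorm.measurable))
      _ = _ := by
        rw [hK]
        ring
  calc _ ≤ (K * eLpNorm (⇑f) (ENNReal.ofReal p) volume ^ p) ^ (1 / p) :=
        ENNReal.rpow_le_rpow hmain (by positivity)
    _ = _ := by
      rw [ENNReal.mul_rpow_of_nonneg _ _ (by positivity), ← ENNReal.rpow_mul,
        mul_one_div_cancel hp0.ne', ENNReal.rpow_one]
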